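/- arXiv:1301.0668 — 5 statements merged into one kernel-verified Lean document; each statement's English description precedes it below -/
import Mathlib

section
/- Let β, δ, μ be real numbers with 0 < δ, 0 < μ < 1 and 1 + μ < β. There exists n₀ (depending only on β, δ, μ) such that for every integer n ≥ n₀ the following holds: let A be the set of all prime numbers p with p ≤ n^μ, let P ∈ ℤ[T] be a nonzero polynomial of degree at most n and height at most exp(n^β) having no root in μ∞ ∪ {0}, and let Q ∈ ℤ[T] be a greatest common divisor of the polynomials P(T^a) with a ∈ A. Then deg(Q) ≤ n^{1−μ+δ} and H(Q) ≤ exp(n^{β−2μ+δ}). -/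
/-- The height of a nonzero integer polynomial: the maximum of the absolute values of its
coefficients divided by their greatest common divisor (the content). -/
noncomputable def intHeight (P : Polynomial ℤ) : ℝ :=
  ((((Finset.range (P.natDegree + 1)).sup fun i => (P.coeff i).natAbs) : ℕ) : ℝ) /
    ((P.content : ℤ) : ℝ)

/-- A complex number is a root of unity. -/
def IsRootOfUnity (z : ℂ) : Prop := ∃ k : ℕ, 0 < k ∧ z ^ k = 1

/-- `Q` is a greatest common divisor in `ℤ[T]` of the set `S` of polynomials. -/
def IsGCDOf (Q : Polynomial ℤ) (S : Set (Polynomial ℤ)) : Prop :=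
  (∀ p ∈ S, Q ∣ p) ∧ ∀ R : Polynomial ℤ, (∀ p ∈ S, R ∣ p) → R ∣ Q

open Finset in
/-- Pruning a dense bipartite graph to one with large minimum degrees. -/
lemma exists_subgraph_min_degree {α β : Type*} [DecidableEq α] [DecidableEq β]
    (E : Finset α) (A : Finset ℕ) (W : Finset β) (f : α → ℕ → β)
    (hf : ∀ z ∈ E, ∀ a ∈ A, f z a ∈ W) (m D : ℕ)
    (h : m * #E + D * #W < #E * #A) :
    ∃ E' ⊆ E, ∃ W' ⊆ W, E'.Nonempty ∧ (∀ z ∈ E', m ≤ #{a ∈ A | f z a ∈ W'}) ∧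
      ∀ w ∈ W', D ≤ #{x ∈ E' ×ˢ A | f x.1 x.2 = w} := by
  set e : Finset α → Finset β → ℕ := fun E' W' => #{x ∈ E' ×ˢ A | f x.1 x.2 ∈ W'} with he
  have e1 : ∀ E' W', e E' W' = ∑ z ∈ E', #{a ∈ A | f z a ∈ W'} := by
    intro E' W'
    simp only [he, card_filter, sum_product]
  have e2 : ∀ E' W', e E' W' = ∑ w ∈ W', #{x ∈ E' ×ˢ A | f x.1 x.2 = w} := by
    intro E' W'
    simp only [he]
    rw [card_eq_sum_card_fiberwise (f := fun x : α × ℕ => f x.1 x.2) (t := W')]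
    · refine sum_congr rfl fun w hw => ?_
      rw [filter_filter]
      congr 1
      ext x
      simp only [mem_filter]
      constructor
      · rintro ⟨h1, h2, h3⟩; exact ⟨h1, h3⟩
      · rintro ⟨h1, rfl⟩; exact ⟨h1, hw, rfl⟩
    · intro x hx
      simpa using (mem_filter.1 hx).2
  let Φ : Finset α × Finset β → ℤ := fun p => (e p.1 p.2 : ℤ) - m * #p.1 - D * #p.2
  obtain ⟨⟨E', W'⟩, hmem, hmax⟩ := exists_max_image (E.powerset ×ˢ W.powerset) Φ
    ⟨(E, W), by simp⟩
  simp only [mem_product, mem_powerset] at hmem hmax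
  have h0 : 0 < Φ (E', W') := by
    refine lt_of_lt_of_le ?_ (hmax (E, W) ⟨subset_rfl, subset_rfl⟩)
    have : e E W = #E * #A := by
      simp only [he]
      rw [← card_product]
      congr 1
      refine filter_true_of_mem fun x hx => ?_
      rw [mem_product] at hx
      exact hf _ hx.1 _ hx.2
    simp only [Φ, this]
    push_cast
    have : ((m * #E + D * #W : ℕ) : ℤ) < ((#E * #A : ℕ) : ℤ) := by exact_mod_cast h
    push_cast at this
    linarith
  refine ⟨E', hmem.1, W', hmem.2, ?_, ?_, ?_⟩
  · rw [nonempty_iff_ne_empty]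
    rintro rfl
    have : e ∅ W' = 0 := by simp [he]
    simp only [Φ, this, card_empty] at h0
    have : (0 : ℤ) ≤ D * #W' := by positivity
    push_cast at h0
    linarith
  · intro z hz
    have hm := hmax (E'.erase z, W') ⟨(erase_subset _ _).trans hmem.1, hmem.2⟩
    simp only [Φ, e1] at hm
    rw [← add_sum_erase _ _ hz, ← card_erase_add_one hz] at hm
    push_cast at hm
    have : (m : ℤ) ≤ #{a ∈ A | f z a ∈ W'} := by linarith
    exact_mod_cast this
  · intro w hw
    have hm := hmax (E', W'.erase w) ⟨hmem.1, (erase_subset _ _).trans hmem.2⟩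
    simp only [Φ, e2] at hm
    rw [← add_sum_erase _ _ hw, ← card_erase_add_one hw] at hm
    push_cast at hm
    have : (D : ℤ) ≤ #{x ∈ E' ×ˢ A | f x.1 x.2 = w} := by linarith
    exact_mod_cast this

/-- An element is determined by two of its powers with coprime exponents. -/
lemma eq_of_pow_eq_of_coprime {F : Type*} [Field F] {x y : F} (hy : y ≠ 0) {a b : ℕ}
    (hab : a.Coprime b) (ha : x ^ a = y ^ a) (hb : x ^ b = y ^ b) : x = y := by
  have h1 : (x / y) ^ a = 1 := by rw [div_pow, ha, div_self (pow_ne_zero _ hy)]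
  have h2 : (x / y) ^ b = 1 := by rw [div_pow, hb, div_self (pow_ne_zero _ hy)]
  have h3 : x / y = 1 := by
    rw [← orderOf_eq_one_iff, ← Nat.dvd_one, ← hab]
    exact Nat.dvd_gcd (orderOf_dvd_of_pow_eq_one h1) (orderOf_dvd_of_pow_eq_one h2)
  exact (div_eq_one_iff_eq hy).1 h3

lemma pow_injective_of_pow_ne_one {F : Type*} [Field F] {z : F} (hz : z ≠ 0)
    (h : ∀ k : ℕ, 0 < k → z ^ k ≠ 1) : Function.Injective fun k : ℕ => z ^ k := by
  have key : ∀ a b : ℕ, z ^ a = z ^ b → ¬ a < b := by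
    intro a b hab hlt
    refine h (b - a) (by omega) ?_
    have : z ^ a * z ^ (b - a) = z ^ a * 1 := by
      rw [← pow_add, Nat.add_sub_cancel' hlt.le, mul_one, hab]
    exact mul_left_cancel₀ (pow_ne_zero _ hz) this
  intro a b hab
  have := key a b hab
  have := key b a hab.symm
  omega

open Finset in
/-- Many walks `z₀, z₁, …` with `zᵢ₊₁ ^ bᵢ = zᵢ ^ aᵢ`, encoded by their exponents and endpoint. -/
lemma exists_many_walks {F : Type*} [Field F] [DecidableEq F] (E W : Finset F) (A : Finset ℕ)
    (hA : ∀ a ∈ A, a.Prime) (hE0 : ∀ z ∈ E, z ≠ 0) (m D k : ℕ)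
    (hm : ∀ z ∈ E, m + k ≤ #{a ∈ A | z ^ a ∈ W})
    (hD : ∀ w ∈ W, D ≤ #{x ∈ E ×ˢ A | x.1 ^ x.2 = w}) {z₀ : F} (hz₀ : z₀ ∈ E) :
    ∀ j ≤ k, ∃ T : Finset (List (ℕ × ℕ) × F), (m * D) ^ j ≤ #T ∧
      ∀ s ∈ T, s.1.length = j ∧ (∀ x ∈ s.1, x.1 ∈ A ∧ x.2 ∈ A) ∧ s.2 ∈ E ∧
        s.2 ^ (s.1.map Prod.snd).prod = z₀ ^ (s.1.map Prod.fst).prod := by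
  intro j
  induction j with
  | zero =>
    intro _
    exact ⟨{([], z₀)}, by simp, by simp [hz₀]⟩
  | succ j ih =>
    intro hj
    obtain ⟨T, hcard, hT⟩ := ih (by omega)
    let S : List (ℕ × ℕ) × F → Finset ℕ := fun s =>
      {a ∈ A | s.2 ^ a ∈ W} \ (s.1.map Prod.snd).toFinset
    let R : List (ℕ × ℕ) × F → Finset (Σ _ : ℕ, F × ℕ) := fun s =>
      (S s).sigma fun a => {x ∈ E ×ˢ A | x.1 ^ x.2 = s.2 ^ a}
    let U := T.sigma R
    let g : (Σ _ : List (ℕ × ℕ) × F, Σ _ : ℕ, F × ℕ) → List (ℕ × ℕ) × F := fun u =>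
      ((u.2.1, u.2.2.2) :: u.1.1, u.2.2.1)
    have hU : ∀ u ∈ U, u.1 ∈ T ∧ u.2.1 ∈ A ∧ u.1.2 ^ u.2.1 ∈ W ∧
        u.2.1 ∉ u.1.1.map Prod.snd ∧ u.2.2.1 ∈ E ∧ u.2.2.2 ∈ A ∧
        u.2.2.1 ^ u.2.2.2 = u.1.2 ^ u.2.1 := by
      intro u hu
      simp only [U, R, S, mem_sigma, mem_sdiff, mem_filter, mem_product, List.mem_toFinset] at hu
      tauto
    refine ⟨U.image g, ?_, ?_⟩
    · rw [card_image_of_injOn]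
      · rw [card_sigma, pow_succ]
        calc (m * D) ^ j * (m * D) ≤ #T * (m * D) := Nat.mul_le_mul_right _ hcard
          _ = ∑ _ ∈ T, m * D := by simp
          _ ≤ _ := by
            refine sum_le_sum fun s hs => ?_
            have hs' := hT s hs
            have h1 : m ≤ #(S s) := by
              have h2 := le_card_sdiff (s.1.map Prod.snd).toFinset ({a ∈ A | s.2 ^ a ∈ W})
              have h3 := List.toFinset_card_le (s.1.map Prod.snd)
              rw [List.length_map, hs'.1] at h3
              have h4 := hm s.2 hs'.2.2.1
              simp only [S]
              omega
            rw [card_sigma]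
            calc m * D ≤ #(S s) * D := Nat.mul_le_mul_right _ h1
              _ = ∑ _ ∈ S s, D := by simp
              _ ≤ _ := by
                refine sum_le_sum fun a ha => hD _ ?_
                simp only [S, mem_sdiff, mem_filter] at ha
                exact ha.1.2
      · rintro ⟨⟨l, z⟩, a, z', b⟩ hu ⟨⟨l₂, z₂⟩, a₂, z₂', b₂⟩ hu₂ heq
        simp only [g, Prod.mk.injEq, List.cons.injEq] at heq
        obtain ⟨⟨⟨rfl, rfl⟩, rfl⟩, rfl⟩ := heq
        obtain ⟨h1, h2, -, h4, -, -, h7⟩ := hU _ hu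
        obtain ⟨k1, -, -, -, -, -, k7⟩ := hU _ hu₂
        have hz : z = z₂ := by
          refine eq_of_pow_eq_of_coprime (a := a) (b := (l.map Prod.snd).prod)
            (hE0 _ (hT _ k1).2.2.1) ?_ (h7.symm.trans k7)
            ((hT _ h1).2.2.2.trans (hT _ k1).2.2.2.symm)
          rw [Nat.coprime_list_prod_right_iff]
          intro b' hb'
          have hb'A : b' ∈ A := by
            obtain ⟨x, hx, rfl⟩ := List.mem_map.1 hb'
            exact ((hT _ h1).2.1 x hx).2
          rw [Nat.coprime_primes (hA _ h2) (hA _ hb'A)]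
          rintro rfl
          exact h4 hb'
        subst hz
        rfl
    · intro s hs
      obtain ⟨u, hu, rfl⟩ := mem_image.1 hs
      obtain ⟨h1, h2, h3, h4, h5, h6, h7⟩ := hU _ hu
      obtain ⟨t1, t2, t3, t4⟩ := hT _ h1
      refine ⟨by simp [g, t1], ?_, h5, ?_⟩
      · intro x hx
        rcases List.mem_cons.1 hx with rfl | hx
        · exact ⟨h2, h6⟩
        · exact t2 x hx
      · simp only [g, List.map_cons, List.prod_cons]
        rw [pow_mul, h7, ← pow_mul, mul_comm, pow_mul, t4, ← pow_mul, mul_comm]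

open Finset in
/-- A walk is determined, up to a permutation of its second exponents, by its first exponents
and its endpoint. -/
lemma card_walks_le {F : Type*} [Field F] [DecidableEq F] (E : Finset F) (A : Finset ℕ)
    (hA : ∀ a ∈ A, a.Prime) (hE : ∀ z ∈ E, z ≠ 0 ∧ ∀ k : ℕ, 0 < k → z ^ k ≠ 1) (k : ℕ) (z₀ : F)
    (T : Finset (List (ℕ × ℕ) × F))
    (hT : ∀ s ∈ T, s.1.length = k ∧ (∀ x ∈ s.1, x.1 ∈ A ∧ x.2 ∈ A) ∧ s.2 ∈ E ∧
        s.2 ^ (s.1.map Prod.snd).prod = z₀ ^ (s.1.map Prod.fst).prod) :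
    #T ≤ k.factorial * (#A ^ k * #E) := by
  let f : List (ℕ × ℕ) × F → List ℕ × F := fun s => (s.1.map Prod.fst, s.2)
  let L : Finset (List ℕ) := (Fintype.piFinset fun _ : Fin k => A).image List.ofFn
  have hL : #L ≤ #A ^ k := by
    refine card_image_le.trans ?_
    simp
  refine (card_le_mul_card_image_of_maps_to (f := f) (t := L ×ˢ E) ?_ k.factorial ?_).trans ?_
  · intro s hs
    obtain ⟨h1, h2, h3, -⟩ := hT s hs
    simp only [f, mem_product]
    refine ⟨?_, h3⟩
    refine mem_image.2 ⟨fun i => (s.1.map Prod.fst).get (i.cast (by simp [h1])), ?_, ?_⟩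
    · rw [Fintype.mem_piFinset]
      intro i
      obtain ⟨x, hx, hxe⟩ := List.mem_map.1
        (List.get_mem (s.1.map Prod.fst) (i.cast (by simp [h1])))
      simp only [List.get_eq_getElem] at hxe ⊢
      rw [← hxe]
      exact (h2 x hx).1
    · refine List.ext_get (by simp [h1]) fun n _ _ => by simp
  · rintro ⟨l, z⟩ -
    rcases (filter (fun s => f s = (l, z)) T).eq_empty_or_nonempty with h | ⟨s₁, hs₁⟩
    · rw [h]; simp
    · obtain ⟨hs₁T, hs₁f⟩ := mem_filter.1 hs₁
      have hlen : (s₁.1.map Prod.snd).length = k := by simp [(hT _ hs₁T).1]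
      have hperm : #((s₁.1.map Prod.snd).permutations.toFinset) ≤ k.factorial := by
        refine (List.toFinset_card_le _).trans ?_
        rw [List.length_permutations, hlen]
      refine le_trans (card_le_card_of_injOn (fun s => s.1.map Prod.snd) ?_ ?_) hperm
      · intro s hs
        obtain ⟨hsT, hsf⟩ := mem_filter.1 hs
        simp only [f, Prod.mk.injEq] at hsf hs₁f
        obtain ⟨-, h2, h3, h4⟩ := hT _ hsT
        obtain ⟨-, k2, -, k4⟩ := hT _ hs₁T
        rw [mem_coe, List.mem_toFinset, List.mem_permutations]
        have hprod : (s.1.map Prod.snd).prod = (s₁.1.map Prod.snd).prod := by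
          refine pow_injective_of_pow_ne_one (hE _ h3).1 (hE _ h3).2 ?_
          have : s.2 = s₁.2 := hsf.2.trans hs₁f.2.symm
          simp only
          rw [h4, this, k4, hsf.1, hs₁f.1]
        refine perm_of_prod_eq_prod hprod ?_ ?_
        · intro p hp
          obtain ⟨x, hx, rfl⟩ := List.mem_map.1 hp
          exact (hA _ (h2 x hx).2).prime
        · intro p hp
          obtain ⟨x, hx, rfl⟩ := List.mem_map.1 hp
          exact (hA _ (k2 x hx).2).prime
      · intro s hs t ht hst
        obtain ⟨hsT, hsf⟩ := mem_filter.1 hs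
        obtain ⟨htT, htf⟩ := mem_filter.1 ht
        simp only [f, Prod.mk.injEq] at hsf htf hst
        refine Prod.ext ?_ (hsf.2.trans htf.2.symm)
        have h1 : s.1.map Prod.fst = t.1.map Prod.fst := hsf.1.trans htf.1.symm
        rw [← List.zip_unzip s.1, ← List.zip_unzip t.1]
        simp only [List.unzip_eq_map, h1, hst]
  · rw [card_product]
    gcongr

open Finset in
/-- Growth of a set of non-torsion elements under raising to powers in a set of primes. -/
lemma mul_card_le_card_biUnion_pow {F : Type*} [Field F] [DecidableEq F] (E : Finset F)
    (A : Finset ℕ) (hA : ∀ a ∈ A, a.Prime)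
    (hE : ∀ z ∈ E, z ≠ 0 ∧ ∀ k : ℕ, 0 < k → z ^ k ≠ 1) (k D K : ℕ)
    (hk : 16 * k ≤ #A) (hK : 4 * D * K ≤ #A) (hD : 16 ^ k * k.factorial * #E < D ^ k) :
    K * #E ≤ #(E.biUnion fun z => A.image (z ^ ·)) := by
  by_contra! hlt
  set W := E.biUnion fun z => A.image (z ^ ·) with hW
  have hEpos : 0 < #E := by
    rcases Nat.eq_zero_or_pos #E with h | h
    · simp [h] at hlt
    · exact h
  have hKpos : 0 < K := by
    rcases Nat.eq_zero_or_pos K with h | h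
    · simp [h] at hlt
    · exact h
  have hDpos : 0 < D := by
    rcases Nat.eq_zero_or_pos D with rfl | h
    · rcases Nat.eq_zero_or_pos k with rfl | h'
      · simp only [pow_zero, Nat.factorial_zero, one_mul] at hD; omega
      · rw [zero_pow h'.ne'] at hD; omega
    · exact h
  have hApos : 0 < #A := by
    have : 0 < 4 * D * K := by positivity
    omega
  obtain ⟨m, hm1, hm2⟩ : ∃ m, #A ≤ 16 * m ∧ 2 * (m + k) ≤ #A := by
    refine ⟨(#A + 15) / 16, by omega, ?_⟩
    rcases Nat.eq_zero_or_pos k with rfl | h'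
    · have : 4 ≤ #A := by
        have : 1 ≤ D * K := Nat.mul_pos hDpos hKpos
        nlinarith
      omega
    · omega
  obtain ⟨E', hE'E, W', -, ⟨z₀, hz₀⟩, h1, h2⟩ := exists_subgraph_min_degree E A W (fun z a => z ^ a)
    (fun z hz a ha => by
      rw [hW, mem_biUnion]
      exact ⟨z, hz, mem_image_of_mem _ ha⟩) (m + k) D (by
        have h3 : D * #W < D * (K * #E) := by gcongr
        nlinarith)
  obtain ⟨T, hT1, hT2⟩ := exists_many_walks E' W' A hA (fun z hz => (hE z (hE'E hz)).1) m D k h1 h2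
    hz₀ k le_rfl
  have h3 := card_walks_le E' A hA (fun z hz => hE z (hE'E hz)) k z₀ T hT2
  have h4 : #E' ≤ #E := card_le_card hE'E
  have hmpos : 0 < m := by omega
  have h5 : m ^ k * D ^ k ≤ m ^ k * (16 ^ k * k.factorial * #E) :=
    calc m ^ k * D ^ k = (m * D) ^ k := (mul_pow _ _ _).symm
      _ ≤ k.factorial * (#A ^ k * #E') := hT1.trans h3
      _ ≤ k.factorial * ((16 * m) ^ k * #E) := by gcongr
      _ = _ := by rw [mul_pow]; ring
  exact absurd (Nat.le_of_mul_le_mul_left h5 (by positivity)) (by omega)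

open Finset in
/-- The Hall-type form of `mul_card_le_card_biUnion_pow`: `K` distinct powers can be assigned to
each element of `E`, disjointly. -/
lemma exists_injective_pow {F : Type*} [Field F] [DecidableEq F] (E : Finset F)
    (A : Finset ℕ) (hA : ∀ a ∈ A, a.Prime)
    (hE : ∀ z ∈ E, z ≠ 0 ∧ ∀ k : ℕ, 0 < k → z ^ k ≠ 1) (k D K : ℕ)
    (hk : 16 * k ≤ #A) (hK : 4 * D * K ≤ #A) (hD : 16 ^ k * k.factorial * #E < D ^ k) :
    ∃ f : E × Fin K → F, Function.Injective f ∧ ∀ x, ∃ a ∈ A, f x = (x.1 : F) ^ a := by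
  obtain ⟨f, hf, hf'⟩ := (Finset.all_card_le_biUnion_card_iff_exists_injective
    (fun x : E × Fin K => A.image ((x.1 : F) ^ ·))).1 (by
      intro s
      set E' : Finset F := s.image fun x => (x.1 : F) with hE'
      have hE'E : E' ⊆ E := by
        intro z hz
        obtain ⟨x, -, rfl⟩ := mem_image.1 hz
        exact x.1.2
      have h1 := mul_card_le_card_biUnion_pow E' A hA (fun z hz => hE z (hE'E hz)) k D K hk hK
        (lt_of_le_of_lt (by gcongr) hD)
      rw [hE', image_biUnion] at h1
      refine le_trans ?_ h1
      refine card_le_mul_card_image s K fun z hz => ?_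
      have := card_le_card_of_injOn (s := {x ∈ s | (x.1 : F) = z}) (t := univ)
        (fun x => x.2) (by simp) (by
          intro x hx y hy hxy
          refine Prod.ext (Subtype.ext ?_) hxy
          exact (mem_filter.1 hx).2.trans (mem_filter.1 hy).2.symm)
      simpa using this)
  refine ⟨f, hf, fun x => ?_⟩
  obtain ⟨a, ha, hax⟩ := mem_image.1 (hf' x)
  exact ⟨a, ha, hax.symm⟩

open Polynomial

lemma rootMultiplicity_le_of_dvd_comp_X_pow {F : Type*} [Field F] [CharZero F] {P Q : F[X]}
    (hP : P ≠ 0) {a : ℕ} (ha : a ≠ 0) (hdvd : Q ∣ P.comp (X ^ a)) {z : F} (hz : z ≠ 0) :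
    Q.rootMultiplicity z ≤ P.rootMultiplicity (z ^ a) := by
  classical
  obtain ⟨R, hPR, hR⟩ := exists_eq_pow_rootMultiplicity_mul_and_not_dvd P hP (z ^ a)
  set m := P.rootMultiplicity (z ^ a)
  have hRz : R.eval (z ^ a) ≠ 0 := fun h => hR (dvd_iff_isRoot.2 h)
  have hsep : (X ^ a - C (z ^ a) : F[X]).Separable :=
    separable_X_pow_sub_C _ (Nat.cast_ne_zero.2 ha) (pow_ne_zero _ hz)
  have hRc : (R.comp (X ^ a)).eval z ≠ 0 := by simpa [eval_comp] using hRz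
  have hcomp : P.comp (X ^ a) = (X ^ a - C (z ^ a)) ^ m * R.comp (X ^ a) := by
    conv_lhs => rw [hPR]
    simp
  have h0 : P.comp (X ^ a) ≠ 0 := by
    rw [hcomp]
    refine mul_ne_zero (pow_ne_zero _ hsep.ne_zero) ?_
    rintro h
    simp [h] at hRc
  calc Q.rootMultiplicity z ≤ (P.comp (X ^ a)).rootMultiplicity z :=
        rootMultiplicity_le_rootMultiplicity_of_dvd h0 hdvd z
    _ = m * (X ^ a - C (z ^ a)).rootMultiplicity z + 0 := by
        rw [hcomp, rootMultiplicity_mul (hcomp ▸ h0), rootMultiplicity_eq_zero (p := R.comp _) hRc,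
          ← count_roots, roots_pow, Multiset.count_nsmul, count_roots]
    _ ≤ m * 1 + 0 := by
        gcongr
        exact rootMultiplicity_le_one_of_separable hsep z
    _ = m := by simp

lemma ne_zero_and_pow_ne_one_of_pow {F : Type*} [Field F] {z : F} {a : ℕ} (ha : a ≠ 0)
    (h : z ^ a ≠ 0 ∧ ∀ k : ℕ, 0 < k → (z ^ a) ^ k ≠ 1) : z ≠ 0 ∧ ∀ k : ℕ, 0 < k → z ^ k ≠ 1 := by
  refine ⟨fun hz => h.1 (by rw [hz, zero_pow ha]), fun k hk hz => h.2 k hk ?_⟩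
  rw [← pow_mul, mul_comm, pow_mul, hz, one_pow]

/-- If `Q` divides many `P(X ^ a)`, sums over the roots of `Q` are bounded by sums over the roots
of `P`, with a gain of a factor `K`. -/
lemma sum_roots_le_sum_roots {F : Type*} [Field F] [CharZero F] {P Q : F[X]} (hP : P ≠ 0)
    {A : Finset ℕ} (hA : ∀ a ∈ A, a.Prime) (hA0 : A.Nonempty)
    (hdvd : ∀ a ∈ A, Q ∣ P.comp (X ^ a))
    (hroot : ∀ z : F, P.IsRoot z → z ≠ 0 ∧ ∀ k : ℕ, 0 < k → z ^ k ≠ 1) {k D K : ℕ}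
    (hk : 16 * k ≤ A.card) (hK : 4 * D * K ≤ A.card)
    (hD : 16 ^ k * k.factorial * Q.natDegree < D ^ k) (g₁ g₂ : F → ℝ) (hg₂ : ∀ z, 0 ≤ g₂ z)
    (hg : ∀ a ∈ A, ∀ z, g₁ z ≤ g₂ (z ^ a)) :
    K * (Q.roots.map g₁).sum ≤ (P.roots.map g₂).sum := by
  classical
  have hQroot : ∀ z ∈ Q.roots, ∀ a ∈ A, P.IsRoot (z ^ a) := by
    intro z hz a ha
    have h1 := (isRoot_of_mem_roots hz).dvd (hdvd a ha)
    simpa [IsRoot, eval_comp] using h1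
  have hE : ∀ z ∈ Q.roots.toFinset, z ≠ 0 ∧ ∀ k : ℕ, 0 < k → z ^ k ≠ 1 := by
    intro z hz
    obtain ⟨a, ha⟩ := hA0
    exact ne_zero_and_pow_ne_one_of_pow (hA a ha).ne_zero
      (hroot _ (hQroot z (Multiset.mem_toFinset.1 hz) a ha))
  have hcard : Q.roots.toFinset.card ≤ Q.natDegree :=
    (Multiset.toFinset_card_le _).trans (card_roots' Q)
  obtain ⟨f, hf, hfa⟩ := exists_injective_pow Q.roots.toFinset A hA hE k D K hk hK
    (lt_of_le_of_lt (by gcongr) hD)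
  rw [Finset.sum_multiset_map_count, Finset.sum_multiset_map_count]
  calc (K : ℝ) * ∑ z ∈ Q.roots.toFinset, Q.roots.count z • g₁ z
      = ∑ x : Q.roots.toFinset × Fin K, Q.roots.count (x.1 : F) • g₁ x.1 := by
        rw [Fintype.sum_prod_type, ← Finset.sum_coe_sort, Finset.mul_sum]
        simp
    _ ≤ ∑ x : Q.roots.toFinset × Fin K, P.roots.count (f x) • g₂ (f x) := by
        refine Finset.sum_le_sum fun x _ => ?_
        obtain ⟨a, ha, hx⟩ := hfa x
        rw [hx, nsmul_eq_mul, nsmul_eq_mul]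
        have h1 : Q.roots.count (x.1 : F) ≤ P.roots.count ((x.1 : F) ^ a) := by
          rw [count_roots, count_roots]
          exact rootMultiplicity_le_of_dvd_comp_X_pow hP (hA a ha).ne_zero (hdvd a ha)
            (hE _ x.1.2).1
        calc _ ≤ (Q.roots.count (x.1 : F) : ℝ) * g₂ ((x.1 : F) ^ a) := by
              gcongr
              exact hg a ha _
          _ ≤ _ := by
              gcongr
              exact hg₂ _
    _ = ∑ w ∈ Finset.univ.image f, P.roots.count w • g₂ w := by
        rw [Finset.sum_image hf.injOn]
    _ ≤ _ := by
        refine Finset.sum_le_sum_of_subset_of_nonneg ?_ fun w _ _ => by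
          have := hg₂ w
          positivity
        intro w hw
        obtain ⟨x, -, rfl⟩ := Finset.mem_image.1 hw
        obtain ⟨a, ha, hx⟩ := hfa x
        rw [hx, Multiset.mem_toFinset, mem_roots hP]
        exact hQroot _ (Multiset.mem_toFinset.1 x.1.2) a ha

/-- If two integer polynomials share a root in some field of characteristic zero, they share a
complex root. -/
lemma exists_complex_common_root {F : Type*} [Field F] [CharZero F] {P R : ℤ[X]} (hP : P ≠ 0)
    {z : F} (hPz : aeval z P = 0) (hRz : aeval z R = 0) :
    ∃ w : ℂ, aeval w P = 0 ∧ aeval w R = 0 := by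
  have hP' : P.map (Int.castRingHom ℚ) ≠ 0 :=
    (Polynomial.map_ne_zero_iff (Int.castRingHom ℚ).injective_int).2 hP
  have haev : ∀ S : ℤ[X], aeval z (S.map (Int.castRingHom ℚ)) = aeval z S := fun S =>
    aeval_map_algebraMap ℚ z S
  have hint : IsIntegral ℚ z := by
    rw [← isAlgebraic_iff_isIntegral]
    exact ⟨_, hP', by rw [haev, hPz]⟩
  obtain ⟨w, hw⟩ := IsAlgClosed.exists_aeval_eq_zero ℂ (minpoly ℚ z) (minpoly.degree_pos hint).ne'
  have key : ∀ S : ℤ[X], aeval z S = 0 → aeval w S = 0 := by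
    intro S hS
    obtain ⟨T, hT⟩ := minpoly.dvd ℚ z ((haev S).trans hS)
    rw [← aeval_map_algebraMap ℚ w S]
    change aeval w (S.map (Int.castRingHom ℚ)) = 0
    rw [hT, map_mul, hw, zero_mul]
  exact ⟨w, key P hPz, key R hRz⟩

lemma gaussNorm_X_sub_C {F : Type*} [NormedField F] (z : F) :
    (X - C z).gaussNorm (NormedField.toAbsoluteValue F) 1 = max 1 ‖z‖ := by
  refine le_antisymm ?_ (max_le ?_ ?_)
  · obtain ⟨i, hi⟩ := (X - C z).exists_eq_gaussNorm (NormedField.toAbsoluteValue F) 1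
    rw [hi, one_pow, mul_one]
    change ‖(X - C z).coeff i‖ ≤ _
    rcases i with _ | _ | i
    · simp
    · simp
    · simp [coeff_X]
  · refine le_trans ?_ ((X - C z).le_gaussNorm (NormedField.toAbsoluteValue F) zero_le_one 1)
    change 1 ≤ ‖(X - C z).coeff 1‖ * _
    simp
  · refine le_trans ?_ ((X - C z).le_gaussNorm (NormedField.toAbsoluteValue F) zero_le_one 0)
    change ‖z‖ ≤ ‖(X - C z).coeff 0‖ * _
    simp

lemma gaussNorm_eq_norm_leadingCoeff_mul_prod_roots {F : Type*} [NormedField F] [IsAlgClosed F]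
    (hna : IsNonarchimedean (norm : F → ℝ)) (P : F[X]) :
    P.gaussNorm (NormedField.toAbsoluteValue F) 1 =
      ‖P.leadingCoeff‖ * (P.roots.map fun z => max 1 ‖z‖).prod := by
  have hna' : IsNonarchimedean (NormedField.toAbsoluteValue F) := hna
  conv_lhs => rw [(IsAlgClosed.splits P).eq_prod_roots]
  rw [gaussNorm_mul hna' one_pos, gaussNorm_C]
  congr 1
  induction P.roots using Multiset.induction_on with
  | empty =>
    simp only [Multiset.map_zero, Multiset.prod_zero]
    rw [← C_1, gaussNorm_C, map_one]
  | cons z s ih =>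
    simp only [Multiset.map_cons, Multiset.prod_cons]
    rw [gaussNorm_mul hna' one_pos, ih, gaussNorm_X_sub_C]

open Real in
/-- The logarithmic form of Gauss's lemma over the algebraic closure of `ℚ_[p]`. -/
lemma sum_posLog_padic_roots (p : ℕ) [Fact p.Prime] {P : ℤ[X]} (hP : P.IsPrimitive) :
    ((P.map (Int.castRingHom (PadicAlgCl p))).roots.map fun z => log⁺ ‖z‖).sum =
      -log ‖((P.leadingCoeff : ℤ) : ℚ_[p])‖ := by
  have hnorm : ∀ c : ℤ, ‖((c : ℤ) : PadicAlgCl p)‖ = ‖(c : ℚ_[p])‖ := by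
    intro c
    rw [← PadicAlgCl.norm_extends, map_intCast]
  have hinj : Function.Injective (Int.castRingHom (PadicAlgCl p)) :=
    (Int.castRingHom (PadicAlgCl p)).injective_int
  set P' := P.map (Int.castRingHom (PadicAlgCl p)) with hP'
  have hg : P'.gaussNorm (NormedField.toAbsoluteValue (PadicAlgCl p)) 1 = 1 := by
    refine le_antisymm ?_ ?_
    · obtain ⟨i, hi⟩ := P'.exists_eq_gaussNorm (NormedField.toAbsoluteValue (PadicAlgCl p)) 1
      rw [hi, one_pow, mul_one]
      change ‖P'.coeff i‖ ≤ 1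
      rw [hP', coeff_map, eq_intCast, hnorm]
      exact Padic.norm_int_le_one _
    · obtain ⟨i, hi⟩ : ∃ i, ¬ (p : ℤ) ∣ P.coeff i := by
        by_contra! h
        have := (C_dvd_iff_dvd_coeff (p : ℤ) P).2 h
        have := hP _ this
        rw [Int.isUnit_iff] at this
        have := (Fact.out : p.Prime).two_le
        omega
      refine le_trans ?_ (P'.le_gaussNorm (NormedField.toAbsoluteValue (PadicAlgCl p))
        zero_le_one i)
      change 1 ≤ ‖P'.coeff i‖ * _
      rw [hP', coeff_map, eq_intCast, hnorm, one_pow, mul_one]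
      by_contra! h
      exact hi (Padic.norm_intCast_lt_one_iff.1 h)
  rw [gaussNorm_eq_norm_leadingCoeff_mul_prod_roots (PadicAlgCl.isNonarchimedean p), hP',
    leadingCoeff_map_of_injective hinj, eq_intCast, hnorm, ← hP'] at hg
  have hlc : ‖((P.leadingCoeff : ℤ) : ℚ_[p])‖ ≠ 0 := by
    rw [norm_ne_zero_iff, Int.cast_ne_zero, leadingCoeff_ne_zero]
    exact hP.ne_zero
  have hne : ∀ x ∈ P'.roots.map fun z => max 1 ‖z‖, x ≠ 0 := by
    intro x hx
    obtain ⟨z, -, rfl⟩ := Multiset.mem_map.1 hx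
    positivity
  have := congrArg log hg
  rw [log_mul hlc (Multiset.prod_ne_zero fun h => hne 0 h rfl), log_one,
    log_multiset_prod hne, Multiset.map_map] at this
  simp only [posLog_eq_log_max_one (norm_nonneg _)]
  simp only [Function.comp_def] at this
  linarith

open Real in
lemma mul_posLog_le_posLog_pow (x : ℝ) {M a : ℕ} (h : M ≤ a) :
    M * log⁺ x ≤ log⁺ (x ^ a) := by
  rw [posLog_pow]
  gcongr
  exact posLog_nonneg

/-- Divisibility of integers can be tested on `p`-adic norms. -/
lemma int_dvd_of_forall_padic_norm_le {a b : ℤ}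
    (h : ∀ (p : ℕ) [Fact p.Prime], ‖(b : ℚ_[p])‖ ≤ ‖(a : ℚ_[p])‖) : a ∣ b := by
  rw [← Int.natAbs_dvd_natAbs, Nat.dvd_iff_prime_pow_dvd_dvd]
  intro p k hp hpk
  have : Fact p.Prime := ⟨hp⟩
  rw [← Int.natCast_dvd] at hpk ⊢
  push_cast at hpk ⊢
  rw [← Padic.norm_int_le_pow_iff_dvd] at hpk ⊢
  exact (h p).trans hpk

open Real in
/-- If `Q` divides many `P(X ^ a)`, its degree and logarithmic Mahler measure are much smaller
than those of `P`. -/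
lemma degree_and_mahlerMeasure_bound {P Q : ℤ[X]} (hP : P.IsPrimitive) (hQ : Q.IsPrimitive)
    {A : Finset ℕ} (hA : ∀ a ∈ A, a.Prime) (hA0 : A.Nonempty)
    (hdvd : ∀ a ∈ A, Q ∣ P.comp (X ^ a))
    (hroot : ∀ z : ℂ, aeval z P = 0 → z ≠ 0 ∧ ∀ k : ℕ, 0 < k → z ^ k ≠ 1) {k D K M : ℕ}
    (hk : 16 * k ≤ A.card) (hK : 4 * D * K ≤ A.card)
    (hD : 16 ^ k * k.factorial * Q.natDegree < D ^ k) (hM : ∀ a ∈ A, M ≤ a) :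
    K * Q.natDegree ≤ P.natDegree ∧
      K * M * (Q.map (Int.castRingHom ℂ)).logMahlerMeasure ≤
        (P.map (Int.castRingHom ℂ)).logMahlerMeasure := by
  have hinj : ∀ (F : Type) [Field F] [CharZero F],
      Function.Injective (Int.castRingHom F) := fun F _ _ => (Int.castRingHom F).injective_int
  have hdeg : ∀ (F : Type) [Field F] [CharZero F] (S : ℤ[X]),
      (S.map (Int.castRingHom F)).natDegree = S.natDegree := fun F _ _ S =>
    natDegree_map_eq_of_injective (hinj F) S
  have main : ∀ (F : Type) [Field F] [CharZero F] (g₁ g₂ : F → ℝ), (∀ z, 0 ≤ g₂ z) →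
      (∀ a ∈ A, ∀ z, g₁ z ≤ g₂ (z ^ a)) →
      K * ((Q.map (Int.castRingHom F)).roots.map g₁).sum ≤
        ((P.map (Int.castRingHom F)).roots.map g₂).sum := by
    intro F _ _ g₁ g₂ hg₂ hg
    refine sum_roots_le_sum_roots ((Polynomial.map_ne_zero_iff (hinj F)).2 hP.ne_zero) hA hA0
      (fun a ha => ?_) ?_ hk hK (by rwa [hdeg]) g₁ g₂ hg₂ hg
    · simpa [map_comp] using Polynomial.map_dvd (Int.castRingHom F) (hdvd a ha)
    · intro z hz
      have hz' : aeval z P = 0 := by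
        rw [IsRoot, eval_map] at hz
        exact hz
      refine ⟨?_, fun j hj hzj => ?_⟩
      · rintro rfl
        obtain ⟨w, hw, hw0⟩ := exists_complex_common_root (R := X) hP.ne_zero hz' (by simp)
        exact (hroot w hw).1 (by simpa using hw0)
      · obtain ⟨w, hw, hw0⟩ := exists_complex_common_root (R := X ^ j - 1) hP.ne_zero hz'
          (by simp [hzj])
        exact (hroot w hw).2 j hj (by simpa [sub_eq_zero] using hw0)
  have hsum : ∀ (F : Type) [NormedField F] [CharZero F],
      K * M * ((Q.map (Int.castRingHom F)).roots.map fun z => log⁺ ‖z‖).sum ≤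
        ((P.map (Int.castRingHom F)).roots.map fun z => log⁺ ‖z‖).sum := by
    intro F _ _
    have := main F (fun z => M * log⁺ ‖z‖) (fun z => log⁺ ‖z‖) (fun _ => posLog_nonneg)
      (fun a ha z => by rw [norm_pow]; exact mul_posLog_le_posLog_pow _ (hM a ha))
    rwa [Multiset.sum_map_mul_left, ← mul_assoc] at this
  refine ⟨?_, ?_⟩
  · have := main ℂ (fun _ => 1) (fun _ => 1) (fun _ => zero_le_one) (fun _ _ _ => le_rfl)
    simp only [Multiset.map_const', Multiset.sum_replicate, nsmul_eq_mul, mul_one,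
      IsAlgClosed.card_roots_eq_natDegree, hdeg] at this
    exact_mod_cast this
  · have hlcQ : Q.leadingCoeff ≠ 0 := leadingCoeff_ne_zero.2 hQ.ne_zero
    have hlcP : P.leadingCoeff ≠ 0 := leadingCoeff_ne_zero.2 hP.ne_zero
    have hlc : Q.leadingCoeff ^ (K * M) ∣ P.leadingCoeff := by
      refine int_dvd_of_forall_padic_norm_le fun p _ => ?_
      have h1 := hsum (PadicAlgCl p)
      rw [sum_posLog_padic_roots p hQ, sum_posLog_padic_roots p hP] at h1
      have hq : 0 < ‖((Q.leadingCoeff : ℤ) : ℚ_[p])‖ := norm_pos_iff.2 (Int.cast_ne_zero.2 hlcQ)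
      have hp : 0 < ‖((P.leadingCoeff : ℤ) : ℚ_[p])‖ := norm_pos_iff.2 (Int.cast_ne_zero.2 hlcP)
      rw [Int.cast_pow, norm_pow, ← log_le_log_iff hp (by positivity), log_pow]
      push_cast
      linarith
    have habs : (K * M : ℝ) * log ‖(Q.leadingCoeff : ℂ)‖ ≤ log ‖(P.leadingCoeff : ℂ)‖ := by
      have h1 := Int.le_of_dvd (abs_pos.2 hlcP) ((abs_dvd_abs _ _).2 hlc)
      rw [abs_pow] at h1
      have h2 : ‖(Q.leadingCoeff : ℂ)‖ ^ (K * M) ≤ ‖(P.leadingCoeff : ℂ)‖ := by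
        rw [Complex.norm_intCast, Complex.norm_intCast]
        exact_mod_cast h1
      have h3 := log_le_log (pow_pos (norm_pos_iff.2 (Int.cast_ne_zero.2 hlcQ)) _) h2
      rw [log_pow] at h3
      push_cast at h3
      exact h3
    rw [logMahlerMeasure_eq_log_leadingCoeff_add_sum_log_roots,
      logMahlerMeasure_eq_log_leadingCoeff_add_sum_log_roots,
      leadingCoeff_map_of_injective (hinj ℂ), leadingCoeff_map_of_injective (hinj ℂ),
      eq_intCast, eq_intCast]
    have := hsum ℂ
    linarith

lemma int_content_nonneg (P : ℤ[X]) : 0 ≤ P.content := by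
  rw [← normalize_content, ← Int.abs_eq_normalize]
  exact abs_nonneg _

lemma abs_coeff_eq_content_mul (P : ℤ[X]) (i : ℕ) :
    |(P.coeff i : ℝ)| = (P.content : ℝ) * |(P.primPart.coeff i : ℝ)| := by
  have h : P.coeff i = P.content * P.primPart.coeff i := by
    conv_lhs => rw [P.eq_C_content_mul_primPart]
    rw [coeff_C_mul]
  rw [h]
  push_cast
  rw [abs_mul, abs_of_nonneg (Int.cast_nonneg (int_content_nonneg P))]

lemma content_cast_pos {P : ℤ[X]} (hP : P ≠ 0) : (0 : ℝ) < P.content := by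
  have hc : P.content ≠ 0 := by rwa [Ne, content_eq_zero_iff]
  exact_mod_cast lt_of_le_of_ne (int_content_nonneg P) hc.symm

lemma abs_coeff_primPart_le_intHeight {P : ℤ[X]} (hP : P ≠ 0) (i : ℕ) :
    |(P.primPart.coeff i : ℝ)| ≤ intHeight P := by
  rw [intHeight, le_div_iff₀ (content_cast_pos hP), mul_comm, ← abs_coeff_eq_content_mul]
  rcases lt_or_ge P.natDegree i with hi | hi
  · rw [coeff_eq_zero_of_natDegree_lt hi]
    simp
  · rw [← Int.cast_abs, Int.abs_eq_natAbs, Int.cast_natCast, Nat.cast_le]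
    exact Finset.le_sup (f := fun i => (P.coeff i).natAbs)
      (Finset.mem_range.2 (Nat.lt_succ_of_le hi))

lemma intHeight_le {P : ℤ[X]} (hP : P ≠ 0) {B : ℝ}
    (h : ∀ i, |(P.primPart.coeff i : ℝ)| ≤ B) : intHeight P ≤ B := by
  rw [intHeight, div_le_iff₀ (content_cast_pos hP)]
  obtain ⟨i, -, hi⟩ := Finset.exists_mem_eq_sup (Finset.range (P.natDegree + 1)) (by simp)
    fun i => (P.coeff i).natAbs
  rw [hi, ← Int.cast_natCast (R := ℝ), ← Int.abs_eq_natAbs, Int.cast_abs,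
    abs_coeff_eq_content_mul, mul_comm B]
  exact mul_le_mul_of_nonneg_left (h i) (content_cast_pos hP).le

open Real in
lemma logMahlerMeasure_primPart_le {P : ℤ[X]} (hP : P ≠ 0) {B : ℝ} (h : intHeight P ≤ exp B) :
    (P.primPart.map (Int.castRingHom ℂ)).logMahlerMeasure ≤ log (P.natDegree + 1) + B := by
  have hne : P.primPart.map (Int.castRingHom ℂ) ≠ 0 :=
    (Polynomial.map_ne_zero_iff (Int.castRingHom ℂ).injective_int).2
      (isPrimitive_primPart P).ne_zero
  rw [logMahlerMeasure_eq_log_MahlerMeasure, log_le_iff_le_exp (mahlerMeasure_pos_of_ne_zero hne),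
    exp_add, exp_log (by positivity)]
  refine (mahlerMeasure_le_sum_norm_coeff _).trans ?_
  rw [sum_over_range _ (by simp),
    natDegree_map_eq_of_injective (Int.castRingHom ℂ).injective_int, natDegree_primPart]
  refine (Finset.sum_le_card_nsmul _ _ (exp B) fun i _ => ?_).trans ?_
  · rw [coeff_map, eq_intCast, Complex.norm_intCast]
    exact (abs_coeff_primPart_le_intHeight hP i).trans h
  · simp

open Real in
lemma intHeight_le_exp {Q : ℤ[X]} (hQ : Q ≠ 0) :
    intHeight Q ≤
      exp (Q.natDegree + (Q.primPart.map (Int.castRingHom ℂ)).logMahlerMeasure) := by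
  have hne : Q.primPart.map (Int.castRingHom ℂ) ≠ 0 :=
    (Polynomial.map_ne_zero_iff (Int.castRingHom ℂ).injective_int).2
      (isPrimitive_primPart Q).ne_zero
  refine intHeight_le hQ fun i => ?_
  have h1 := norm_coeff_le_choose_mul_mahlerMeasure i (Q.primPart.map (Int.castRingHom ℂ))
  rw [coeff_map, eq_intCast, Complex.norm_intCast,
    natDegree_map_eq_of_injective (Int.castRingHom ℂ).injective_int, natDegree_primPart] at h1
  refine h1.trans ?_
  rw [exp_add, logMahlerMeasure_eq_log_MahlerMeasure,
    exp_log (mahlerMeasure_pos_of_ne_zero hne)]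
  refine mul_le_mul_of_nonneg_right ?_ (mahlerMeasure_nonneg _)
  calc ((Q.natDegree.choose i : ℕ) : ℝ) ≤ ((2 ^ Q.natDegree : ℕ) : ℝ) := by
        exact_mod_cast Nat.choose_le_two_pow _ _
    _ = 2 ^ Q.natDegree := by push_cast; rfl
    _ ≤ exp 1 ^ Q.natDegree := by
        gcongr
        linarith [add_one_le_exp (1 : ℝ)]
    _ = exp Q.natDegree := by rw [← exp_nat_mul, mul_one]

lemma primPart_dvd_primPart_comp {P Q : ℤ[X]} (hP : P ≠ 0) {a : ℕ} (ha : a ≠ 0)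
    (h : Q ∣ P.comp (X ^ a)) : Q.primPart ∣ P.primPart.comp (X ^ a) := by
  have hcomp : P.comp (X ^ a) = C P.content * P.primPart.comp (X ^ a) := by
    conv_lhs => rw [P.eq_C_content_mul_primPart]
    simp
  have h0 : P.comp (X ^ a) ≠ 0 := by
    intro h0
    rw [comp_eq_zero_iff] at h0
    rcases h0 with h0 | ⟨-, h0⟩
    · exact hP h0
    · have := congrArg natDegree h0
      rw [natDegree_C, natDegree_X_pow] at this
      exact ha this
  have h1 : Q.primPart ∣ P.comp (X ^ a) :=
    (Dvd.intro_left _ Q.eq_C_content_mul_primPart.symm).trans h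
  rw [← (isPrimitive_primPart Q).dvd_primPart_iff_dvd h0, hcomp, primPart_mul (hcomp ▸ h0),
    (isUnit_primPart_C _).dvd_mul_left] at h1
  exact h1.trans (Dvd.intro_left _ (eq_C_content_mul_primPart _).symm)

open Filter Real in
/-- A weak form of Chebyshev's lower bound for the number of primes. -/
lemma eventually_rpow_le_primeCounting {ε : ℝ} (hε : 0 < ε) :
    ∀ᶠ x : ℝ in atTop, 3 * x ^ (1 - ε) ≤ (Nat.primeCounting ⌊x⌋₊ : ℝ) := by
  have h1 := (isLittleO_log_rpow_atTop hε).bound (show (0 : ℝ) < 1 / 12 by norm_num)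
  have h2 := (tendsto_atTop_add_const_right atTop (2 : ℝ) tendsto_id).eventually
    (isLittleO_log_id_atTop.bound (show (0 : ℝ) < 1 / 10 by norm_num))
  filter_upwards [h1, h2, eventually_ge_atTop (10 : ℝ)] with x h1 h2 hx
  have hlog : 0 < log x := log_pos (by linarith)
  have hlog2 : 0 < log (x + 2) := log_pos (by linarith)
  have hxε : 0 < x ^ ε := by positivity
  simp only [id, norm_eq_abs] at h1 h2
  rw [abs_of_pos hlog, abs_of_pos hxε] at h1
  rw [abs_of_pos hlog2, abs_of_pos (by linarith)] at h2
  refine le_trans ?_ (Chebyshev.pi_ge' (by linarith))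
  have h3 : x / 4 ≤ (x - 1) * log 2 - log (x + 2) := by nlinarith [log_two_gt_d9]
  rw [le_div_iff₀ hlog]
  calc 3 * x ^ (1 - ε) * log x ≤ 3 * x ^ (1 - ε) * (1 / 12 * x ^ ε) := by gcongr
    _ = (x ^ (1 - ε) * x ^ ε) / 4 := by ring
    _ = x / 4 := by rw [← rpow_add (by linarith), sub_add_cancel, rpow_one]
    _ ≤ _ := h3

open Filter Real in
/-- The primes up to `n ^ μ`, without the smallest ones, meet the requirements of
`degree_and_mahlerMeasure_bound` for polynomials `Q` of degree at most `n ^ 2`. -/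
lemma exists_eventually_prime_set {μ η : ℝ} (hη : 0 < η) (hημ : 4 * η ≤ μ) :
    ∃ k : ℕ, ∀ᶠ n : ℕ in atTop, ∃ (A : Finset ℕ) (D K M : ℕ),
      (∀ a ∈ A, a.Prime ∧ (a : ℝ) ≤ (n : ℝ) ^ μ ∧ M ≤ a) ∧ A.Nonempty ∧ 16 * k ≤ A.card ∧
      4 * D * K ≤ A.card ∧ 16 ^ k * k.factorial * n ^ 2 < D ^ k ∧
      (n : ℝ) ^ (μ - 3 * η) ≤ K ∧ (n : ℝ) ^ (μ - η) ≤ M := by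
  have hμ : 0 < μ := by linarith
  obtain ⟨k, hk⟩ := exists_nat_ge (3 / η)
  rw [div_le_iff₀ hη] at hk
  refine ⟨k, ?_⟩
  have e1 := (tendsto_rpow_atTop hμ).eventually
    (eventually_rpow_le_primeCounting (ε := η / μ) (by positivity))
  have e2 := (tendsto_rpow_atTop (show 0 < μ - η by linarith)).eventually_ge_atTop
    (16 * (k : ℝ) + 1)
  have e3 := eventually_gt_atTop ((16 : ℝ) ^ k * k.factorial)
  have e4 := (tendsto_rpow_atTop hη).eventually_ge_atTop (16 : ℝ)
  have e5 := eventually_ge_atTop (1 : ℝ)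
  filter_upwards [tendsto_natCast_atTop_atTop.eventually
    (e1.and (e2.and (e3.and (e4.and e5))))] with n hn
  obtain ⟨e1, e2, e3, e4, e5⟩ := hn
  set x : ℝ := (n : ℝ) with hx
  have hx0 : 0 < x := by linarith
  rw [← rpow_mul hx0.le, show μ * (1 - η / μ) = μ - η by field_simp] at e1
  set M := ⌈x ^ (μ - η)⌉₊ with hM
  set N := ⌊x ^ μ⌋₊ with hN
  set A := (Finset.range (N + 1)).filter Nat.Prime \ Finset.range M with hA
  set D := ⌈x ^ η⌉₊ with hD
  have hMle : (M : ℝ) < x ^ (μ - η) + 1 := Nat.ceil_lt_add_one (by positivity)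
  have hk0 : (0 : ℝ) ≤ k := k.cast_nonneg
  have hcard : x ^ (μ - η) ≤ A.card := by
    have h1 := Finset.le_card_sdiff (Finset.range M) ((Finset.range (N + 1)).filter Nat.Prime)
    rw [Finset.card_range, ← Nat.count_eq_card_filter_range, ← hA] at h1
    have h2 : (Nat.primeCounting N : ℝ) - M ≤ A.card := by
      rw [sub_le_iff_le_add]
      have : Nat.primeCounting N ≤ A.card + M := by
        rw [Nat.primeCounting, Nat.primeCounting']
        omega
      exact_mod_cast this
    linarith
  have hDle : (D : ℝ) ≤ 2 * x ^ η := by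
    have := Nat.ceil_lt_add_one (show 0 ≤ x ^ η by positivity)
    linarith
  have hDge : x ^ η ≤ D := Nat.le_ceil _
  have hDpos : (0 : ℝ) < D := by linarith
  refine ⟨A, D, A.card / (4 * D), M, ?_, ?_, ?_, Nat.mul_div_le _ _, ?_, ?_, Nat.le_ceil _⟩
  · intro a ha
    simp only [hA, Finset.mem_sdiff, Finset.mem_filter, Finset.mem_range, not_lt] at ha
    refine ⟨ha.1.2, ?_, ha.2⟩
    exact (Nat.le_floor_iff (by positivity)).1 (Nat.lt_succ_iff.1 ha.1.1)
  · rw [← Finset.card_pos, ← Nat.cast_pos (α := ℝ)]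
    linarith
  · have : ((16 * k : ℕ) : ℝ) ≤ A.card := by push_cast; linarith
    exact_mod_cast this
  · have : ((16 ^ k * k.factorial * n ^ 2 : ℕ) : ℝ) < ((D ^ k : ℕ) : ℝ) := by
      push_cast
      calc (16 : ℝ) ^ k * k.factorial * x ^ 2 < x * x ^ 2 := by gcongr
        _ = x ^ (3 : ℝ) := by norm_cast; ring
        _ ≤ x ^ (η * k) := rpow_le_rpow_of_exponent_le e5 (by linarith)
        _ = (x ^ η) ^ k := by rw [rpow_mul hx0.le, rpow_natCast]
        _ ≤ (D : ℝ) ^ k := by gcongr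
    exact_mod_cast this
  · have h1 : (A.card : ℝ) / (4 * D) < ((A.card / (4 * D) : ℕ) : ℝ) + 1 := by
      rw [div_lt_iff₀ (by positivity)]
      have := Nat.lt_mul_div_succ A.card (show 0 < 4 * D by
        have : 0 < D := by exact_mod_cast hDpos
        omega)
      rw [mul_comm] at this
      exact_mod_cast this
    have h2 : 1 ≤ x ^ (μ - 3 * η) := one_le_rpow e5 (by linarith)
    have h3 : 2 * x ^ (μ - 3 * η) ≤ (A.card : ℝ) / (4 * D) := by
      rw [le_div_iff₀ (by positivity)]
      calc 2 * x ^ (μ - 3 * η) * (4 * D) ≤ 2 * x ^ (μ - 3 * η) * (4 * (2 * x ^ η)) := by gcongr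
        _ = 16 * (x ^ (μ - 3 * η) * x ^ η) := by ring
        _ ≤ x ^ η * (x ^ (μ - 3 * η) * x ^ η) := by gcongr
        _ = x ^ (μ - η) := by
          rw [← rpow_add hx0, ← rpow_add hx0]
          congr 1
          ring
        _ ≤ A.card := hcard
    linarith

open Filter Real in
/-- gcd estimate, Theorem 1.2 analog for the multiplicative group. -/
theorem stmt_1 (β δ μ : ℝ) (hδ : 0 < δ) (hμ0 : 0 < μ) (hμ1 : μ < 1) (hβ : 1 + μ < β) :
    ∃ n₀ : ℕ, ∀ n : ℕ, n₀ ≤ n →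
      ∀ P Q : Polynomial ℤ, P ≠ 0 → P.natDegree ≤ n →
        intHeight P ≤ Real.exp ((n : ℝ) ^ β) →
        (∀ z : ℂ, Polynomial.aeval z P = 0 → z ≠ 0 ∧ ¬ IsRootOfUnity z) →
        IsGCDOf Q {F | ∃ a : ℕ, Nat.Prime a ∧ (a : ℝ) ≤ (n : ℝ) ^ μ ∧
          F = P.comp (Polynomial.X ^ a)} →
        (Q.natDegree : ℝ) ≤ (n : ℝ) ^ (1 - μ + δ) ∧
          intHeight Q ≤ Real.exp ((n : ℝ) ^ (β - 2 * μ + δ)) := by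
  classical
  obtain ⟨η, hη, hημ, hηδ⟩ : ∃ η : ℝ, 0 < η ∧ 4 * η ≤ μ ∧ 5 * η ≤ δ :=
    ⟨min μ δ / 5, by positivity, by linarith [min_le_left μ δ], by linarith [min_le_right μ δ]⟩
  obtain ⟨k, hk⟩ := exists_eventually_prime_set hη hημ
  have e1 := tendsto_natCast_atTop_atTop.eventually
    ((isLittleO_log_rpow_atTop (show 0 < β by linarith)).bound (show (0 : ℝ) < 1 / 2 by norm_num))
  have e2 := tendsto_natCast_atTop_atTop.eventually
    ((tendsto_rpow_atTop (show 0 < β by linarith)).eventually_ge_atTop (2 : ℝ))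
  have e3 := tendsto_natCast_atTop_atTop.eventually
    ((tendsto_rpow_atTop hη).eventually_ge_atTop (3 : ℝ))
  obtain ⟨n₀, hn₀⟩ := eventually_atTop.1 (hk.and (e1.and (e2.and (e3.and
    (eventually_ge_atTop 1)))))
  refine ⟨n₀, fun n hn P Q hP hPdeg hPH hroot hQ => ?_⟩
  obtain ⟨⟨A, D, K, M, hA, hA0, hkA, hKA, hDk, hK, hM⟩, e1, e2, e3, e4⟩ := hn₀ n hn
  have hdvd : ∀ a ∈ A, Q ∣ P.comp (X ^ a) := fun a ha =>
    hQ.1 _ ⟨a, (hA a ha).1, (hA a ha).2.1, rfl⟩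
  have hdvd' : ∀ a ∈ A, Q.primPart ∣ P.primPart.comp (X ^ a) := fun a ha =>
    primPart_dvd_primPart_comp hP (hA a ha).1.ne_zero (hdvd a ha)
  set x : ℝ := (n : ℝ) with hx
  have hx1 : 1 ≤ x := Nat.one_le_cast.2 e4
  have hx0 : 0 < x := by linarith
  obtain ⟨a₀, ha₀⟩ := hA0
  have hcomp0 : P.comp (X ^ a₀) ≠ 0 := by
    rw [← expand_eq_comp_X_pow]
    exact (expand_ne_zero (hA a₀ ha₀).1.pos).2 hP
  have hQ0 : Q ≠ 0 := ne_zero_of_dvd_ne_zero hcomp0 (hdvd a₀ ha₀)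
  have ha₀n : a₀ ≤ n := by
    have h1 := (hA a₀ ha₀).2.1.trans (rpow_le_rpow_of_exponent_le hx1 hμ1.le)
    rw [rpow_one] at h1
    exact Nat.cast_le.1 h1
  have hQn : Q.natDegree ≤ n ^ 2 := by
    refine (natDegree_le_of_dvd (hdvd a₀ ha₀) hcomp0).trans ?_
    rw [natDegree_comp, natDegree_X_pow, sq]
    exact Nat.mul_le_mul hPdeg ha₀n
  have hroot' : ∀ z : ℂ, aeval z P.primPart = 0 → z ≠ 0 ∧ ∀ k : ℕ, 0 < k → z ^ k ≠ 1 := by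
    intro z hz
    have hzP : aeval z P = 0 := by
      rw [P.eq_C_content_mul_primPart, map_mul, hz, mul_zero]
    exact ⟨(hroot z hzP).1, fun j hj hzj => (hroot z hzP).2 ⟨j, hj, hzj⟩⟩
  obtain ⟨hdeg, hmahler⟩ := degree_and_mahlerMeasure_bound (isPrimitive_primPart P)
    (isPrimitive_primPart Q) (fun a ha => (hA a ha).1) ⟨a₀, ha₀⟩ hdvd' hroot' hkA hKA
    (by
      rw [natDegree_primPart]
      exact lt_of_le_of_lt (by gcongr) hDk) (fun a ha => (hA a ha).2.2)
  rw [natDegree_primPart, natDegree_primPart] at hdeg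
  have hdegQ : (Q.natDegree : ℝ) ≤ x ^ (1 - μ + 3 * η) := by
    have h1 : (K : ℝ) * Q.natDegree ≤ x := by
      rw [hx]
      exact_mod_cast hdeg.trans hPdeg
    have h2 : x ^ (μ - 3 * η) * Q.natDegree ≤ x :=
      (mul_le_mul_of_nonneg_right hK (Nat.cast_nonneg _)).trans h1
    rw [← le_div_iff₀' (by positivity)] at h2
    rwa [show 1 - μ + 3 * η = 1 - (μ - 3 * η) by ring, rpow_sub hx0, rpow_one]
  have hLP := logMahlerMeasure_primPart_le hP hPH
  set L := (Q.primPart.map (Int.castRingHom ℂ)).logMahlerMeasure with hL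
  have hL0 : 0 ≤ L := by
    rw [hL, logMahlerMeasure_eq_log_MahlerMeasure]
    exact log_nonneg (one_le_mahlerMeasure_of_ne_zero (isPrimitive_primPart Q).ne_zero)
  have hlogdeg : log (P.natDegree + 1) ≤ x ^ β := by
    have h1 : log (P.natDegree + 1) ≤ log (2 * x) := by
      refine log_le_log (by positivity) ?_
      have : (P.natDegree : ℝ) ≤ x := Nat.cast_le.2 hPdeg
      linarith
    rw [log_mul two_ne_zero hx0.ne'] at h1
    rw [norm_of_nonneg (log_nonneg hx1), norm_of_nonneg (by positivity)] at e1
    linarith [log_two_lt_d9]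
  have hLQ : L ≤ 2 * x ^ (β - 2 * μ + 4 * η) := by
    have h1 : x ^ (2 * μ - 4 * η) * L ≤ 2 * x ^ β :=
      calc x ^ (2 * μ - 4 * η) * L = x ^ (μ - 3 * η) * x ^ (μ - η) * L := by
            rw [← rpow_add hx0]
            congr 2
            ring
        _ ≤ K * M * L := by gcongr
        _ ≤ _ := by linarith
    rw [← le_div_iff₀' (by positivity)] at h1
    rwa [show β - 2 * μ + 4 * η = β - (2 * μ - 4 * η) by ring, rpow_sub hx0, ← mul_div_assoc]
  refine ⟨hdegQ.trans (rpow_le_rpow_of_exponent_le hx1 (by linarith)), ?_⟩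
  refine (intHeight_le_exp hQ0).trans (exp_le_exp.2 ?_)
  calc (Q.natDegree : ℝ) + L ≤ x ^ (1 - μ + 3 * η) + 2 * x ^ (β - 2 * μ + 4 * η) := by gcongr
    _ ≤ x ^ (β - 2 * μ + 4 * η) + 2 * x ^ (β - 2 * μ + 4 * η) := by
        gcongr ?_ + _
        exact rpow_le_rpow_of_exponent_le hx1 (by linarith)
    _ = 3 * x ^ (β - 2 * μ + 4 * η) := by ring
    _ ≤ x ^ η * x ^ (β - 2 * μ + 4 * η) := by gcongr
    _ = x ^ (β - 2 * μ + 5 * η) := by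
        rw [← rpow_add hx0]
        congr 1
        ring
    _ ≤ _ := rpow_le_rpow_of_exponent_le hx1 (by linarith)
end

section
/- Let G be an abelian group (written multiplicatively) with torsion subgroup G_tor, and let A be a finite set of prime numbers with |A| ≥ 2. For a subset E of G put O(E) = { x^p : x ∈ E, p ∈ A }, and for x ∈ G and an integer k ≥ 1 let C_k(x) be the set of y ∈ G such that x^{p₁⋯p_k} = y^{q₁⋯q_k} for some (not necessarily distinct) primes p₁,…,p_k, q₁,…,q_k ∈ A, with C₀(x) = {x}. Let E and F be finite nonempty subsets of G with O(E) ⊆ F and E ∩ G_tor = ∅, and suppose |F| ≤ (1/(2^{ℓ+1}(ℓ+1)!))·binom(|A|, ℓ+2) for some integer ℓ with 0 ≤ ℓ ≤ |A| − 2. Then there exist an integer r ≥ 1, points x₁,…,x_r of E, and partitions E = E₁ ⊔ ⋯ ⊔ E_r and F = F₁ ⊔ ⋯ ⊔ F_r ⊔ F_{r+1} such that, for each i = 1,…,r: (a) E_i ⊆ C_ℓ(x_i), (b) F_i ⊆ O(E_i), and (c) |F_i| ≥ ((|A|−ℓ)/(2(ℓ+1)))·|E_i|. -/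
/-- The products of exactly `k` (not necessarily distinct) elements of `A`. -/
def IsProdOf (A : Finset ℕ) (k n : ℕ) : Prop :=
  ∃ s : Multiset ℕ, s.card = k ∧ (∀ p ∈ s, p ∈ A) ∧ s.prod = n

/-- `y` belongs to `C_k(x)`. -/
def PowRelated {G : Type*} [CommGroup G] (A : Finset ℕ) (k : ℕ) (x y : G) : Prop :=
  ∃ P Q : ℕ, IsProdOf A k P ∧ IsProdOf A k Q ∧ x ^ P = y ^ Q

/-- The set `O(E)` of all `x ^ p` with `x ∈ E` and `p ∈ A`. -/
def powImage {G : Type*} [CommGroup G] [DecidableEq G] (A : Finset ℕ) (E : Finset G) :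
    Finset G :=
  E.biUnion fun y => A.image fun p => y ^ p

theorem mem_powImage {G : Type*} [CommGroup G] [DecidableEq G] {A : Finset ℕ} {E : Finset G}
    {z : G} : z ∈ powImage A E ↔ ∃ y ∈ E, ∃ p ∈ A, y ^ p = z := by
  simp [powImage]

theorem IsProdOf.mul {A : Finset ℕ} {k n p : ℕ} (h : IsProdOf A k n) (hp : p ∈ A) :
    IsProdOf A (k + 1) (n * p) := by
  obtain ⟨s, rfl, hs, rfl⟩ := h
  refine ⟨p ::ₘ s, by simp, ?_, by simp [mul_comm]⟩
  intro q hq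
  rcases Multiset.mem_cons.1 hq with rfl | hq
  exacts [hp, hs q hq]

theorem IsProdOf.exists_fin {A : Finset ℕ} {k n : ℕ} (h : IsProdOf A k n) :
    ∃ p : Fin k → ℕ, (∀ i, p i ∈ A) ∧ ∏ i, p i = n := by
  obtain ⟨s, hk, hs, rfl⟩ := h
  induction s using Quotient.inductionOn with
  | h l =>
    subst hk
    exact ⟨fun i : Fin l.length => l.get i, fun i => hs _ (List.get_mem l i),
      Fin.prod_univ_getElem l⟩

theorem mem_of_prime_dvd_prod {A : Finset ℕ} (hA : ∀ p ∈ A, p.Prime) {s : Multiset ℕ}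
    (hs : ∀ p ∈ s, p ∈ A) {p : ℕ} (hp : p.Prime) (hd : p ∣ s.prod) : p ∈ s := by
  obtain ⟨q, hq, hpq⟩ := hp.prime.exists_mem_multiset_dvd hd
  rwa [(Nat.prime_dvd_prime_iff_eq hp (hA q (hs q hq))).1 hpq]

theorem IsProdOf.pos {A : Finset ℕ} (hA : ∀ p ∈ A, p.Prime) {k n : ℕ} (h : IsProdOf A k n) :
    0 < n := by
  obtain ⟨s, rfl, hs, rfl⟩ := h
  exact Multiset.prod_pos fun p hp => (hA p (hs p hp)).pos

theorem IsProdOf.card_dvd_le {A : Finset ℕ} (hA : ∀ p ∈ A, p.Prime) {k n : ℕ}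
    (h : IsProdOf A k n) : (A.filter (· ∣ n)).card ≤ k := by
  obtain ⟨s, rfl, hs, rfl⟩ := h
  refine le_trans (Finset.card_le_card ?_) (Multiset.toFinset_card_le s)
  intro p hp
  rw [Finset.mem_filter] at hp
  exact Multiset.mem_toFinset.2 (mem_of_prime_dvd_prod hA hs (hA p hp.1) hp.2)

theorem IsProdOf.exists_of_dvd {A : Finset ℕ} (hA : ∀ p ∈ A, p.Prime) {k n p : ℕ}
    (h : IsProdOf A (k + 1) n) (hp : p ∈ A) (hd : p ∣ n) :
    ∃ m, IsProdOf A k m ∧ n = m * p := by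
  obtain ⟨s, hk, hs, rfl⟩ := h
  have hmem := mem_of_prime_dvd_prod hA hs (hA p hp) hd
  obtain ⟨t, rfl⟩ := Multiset.exists_cons_of_mem hmem
  refine ⟨t.prod, ⟨t, by simpa using hk, fun q hq => hs q (Multiset.mem_cons_of_mem hq), rfl⟩, ?_⟩
  simp [mul_comm]

theorem PowRelated.mono {G : Type*} [CommGroup G] {A : Finset ℕ} (hA : A.Nonempty) {k ℓ : ℕ}
    (hkl : k ≤ ℓ) {x y : G} (h : PowRelated A k x y) : PowRelated A ℓ x y := by
  obtain ⟨p, hp⟩ := hA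
  induction ℓ, hkl using Nat.le_induction with
  | base => exact h
  | succ m _ ih =>
    obtain ⟨P, Q, hP, hQ, e⟩ := ih
    exact ⟨P * p, Q * p, hP.mul hp, hQ.mul hp, by rw [pow_mul, pow_mul, e]⟩

theorem PowRelated.refl {G : Type*} [CommGroup G] {A : Finset ℕ} (x : G) :
    PowRelated A 0 x x :=
  ⟨1, 1, ⟨0, by simp⟩, ⟨0, by simp⟩, rfl⟩

theorem PowRelated.step {G : Type*} [CommGroup G] {A : Finset ℕ} {k : ℕ} {x y z : G} {p q : ℕ}
    (h : PowRelated A k x z) (hp : p ∈ A) (hq : q ∈ A) (e : y ^ p = z ^ q) :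
    PowRelated A (k + 1) x y := by
  obtain ⟨P, Q, hP, hQ, e'⟩ := h
  refine ⟨P * q, Q * p, hP.mul hq, hQ.mul hp, ?_⟩
  rw [pow_mul, e', ← pow_mul, mul_comm, pow_mul, ← e, ← pow_mul, mul_comm]

theorem pow_right_injective_of_not_isOfFinOrder {G : Type*} [CommGroup G] {x : G}
    (hx : ¬ IsOfFinOrder x) {m n : ℕ} (h : x ^ m = x ^ n) : m = n :=
  injective_pow_iff_not_isOfFinOrder.2 hx h

theorem eq_of_pow_eq_of_coprime_s8 {G : Type*} [CommGroup G] {a b : G} {m n : ℕ}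
    (hmn : m.Coprime n) (hm : a ^ m = b ^ m) (hn : a ^ n = b ^ n) : a = b := by
  rw [← div_eq_one, ← orderOf_eq_one_iff]
  refine Nat.eq_one_of_dvd_coprimes hmn (orderOf_dvd_of_pow_eq_one ?_)
    (orderOf_dvd_of_pow_eq_one ?_)
  · rw [div_pow, hm, div_self']
  · rw [div_pow, hn, div_self']

/-- A relation `x ^ (P' * p) = y ^ (Q' * p)` may be divided by the prime `p` as soon as `x` and `y`
satisfy another relation in which the exponent of `y` is prime to `p`. -/
theorem pow_eq_of_pow_mul_eq {G : Type*} [CommGroup G] {x y : G} (hx : ¬ IsOfFinOrder x)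
    {P Q P' Q' p : ℕ} (hp : p.Prime) (hpQ : ¬ p ∣ Q) (h : x ^ P = y ^ Q)
    (h' : x ^ (P' * p) = y ^ (Q' * p)) : x ^ P' = y ^ Q' := by
  have key : P * Q' = P' * Q := by
    have : x ^ (P * (Q' * p)) = x ^ (P' * p * Q) := by
      rw [pow_mul, h, pow_mul x, h', ← pow_mul, ← pow_mul, mul_comm]
    have := pow_right_injective_of_not_isOfFinOrder hx this
    apply Nat.eq_of_mul_eq_mul_right hp.pos
    linarith
  refine eq_of_pow_eq_of_coprime_s8 ((Nat.Prime.coprime_iff_not_dvd hp).2 hpQ) ?_ ?_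
  · rw [← pow_mul, ← pow_mul, h']
  · rw [← pow_mul, ← key, pow_mul, h, ← pow_mul, ← pow_mul, mul_comm]

/-- Lower bound for `|O(S)|` when `S ⊆ C_k(x)`. -/
theorem card_mul_le_card_powImage {G : Type*} [CommGroup G] [DecidableEq G] {A : Finset ℕ}
    (hA : ∀ p ∈ A, p.Prime) {x : G} (hx : ¬ IsOfFinOrder x) {k : ℕ} {S : Finset G}
    (hS : ∀ y ∈ S, ¬ IsOfFinOrder y) (hrel : ∀ y ∈ S, PowRelated A k x y) :
    S.card * (A.card - k) ≤ (powImage A S).card * (k + 1) := by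
  classical
  have hrel' : ∀ y : G, ∃ P Q : ℕ, y ∈ S → IsProdOf A k P ∧ IsProdOf A k Q ∧ x ^ P = y ^ Q := by
    intro y
    by_cases hy : y ∈ S
    · obtain ⟨P, Q, h⟩ := hrel y hy
      exact ⟨P, Q, fun _ => h⟩
    · exact ⟨0, 0, fun h => absurd h hy⟩
  choose P Q hPQ using hrel'
  refine Finset.card_mul_le_card_mul (fun y z => ∃ p ∈ A, ¬ p ∣ Q y ∧ y ^ p = z) ?_ ?_
  · intro y hy
    have hsub : (A.filter fun p => ¬ p ∣ Q y).image (fun p => y ^ p) ⊆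
        Finset.bipartiteAbove (fun y z => ∃ p ∈ A, ¬ p ∣ Q y ∧ y ^ p = z) (powImage A S) y := by
      intro z hz
      obtain ⟨p, hp, rfl⟩ := Finset.mem_image.1 hz
      rw [Finset.mem_filter] at hp
      rw [Finset.mem_bipartiteAbove]
      exact ⟨mem_powImage.2 ⟨y, hy, p, hp.1, rfl⟩, p, hp.1, hp.2, rfl⟩
    refine le_trans ?_ (Finset.card_le_card hsub)
    rw [Finset.card_image_of_injective _
      (fun m n h => pow_right_injective_of_not_isOfFinOrder (hS y hy) h)]
    have h1 := Finset.card_filter_add_card_filter_not (s := A) (fun p => p ∣ Q y)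
    have h2 := (hPQ y hy).2.1.card_dvd_le hA
    omega
  · intro z _
    rcases (Finset.bipartiteBelow (fun y z => ∃ p ∈ A, ¬ p ∣ Q y ∧ y ^ p = z)
      S z).eq_empty_or_nonempty with h | ⟨y₀, h₀⟩
    · simp [h]
    · rw [Finset.mem_bipartiteBelow] at h₀
      obtain ⟨hy₀, p₀, hp₀, hd₀, e₀⟩ := h₀
      obtain ⟨hP₀, hQ₀, r₀⟩ := hPQ y₀ hy₀
      refine le_trans ?_ ((hP₀.mul hp₀).card_dvd_le hA)
      have hex : ∀ y : G, ∃ p : ℕ,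
          y ∈ Finset.bipartiteBelow (fun y z => ∃ p ∈ A, ¬ p ∣ Q y ∧ y ^ p = z) S z →
          p ∈ A ∧ ¬ p ∣ Q y ∧ y ^ p = z := by
        intro y
        by_cases hy : y ∈ Finset.bipartiteBelow (fun y z => ∃ p ∈ A, ¬ p ∣ Q y ∧ y ^ p = z) S z
        · obtain ⟨_, p, h⟩ := Finset.mem_bipartiteBelow _ |>.1 hy
          exact ⟨p, fun _ => h⟩
        · exact ⟨0, fun h => absurd h hy⟩
      choose f hf using hex
      refine Finset.card_le_card_of_injOn f ?_ ?_
      · intro y hy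
        obtain ⟨hfA, hfd, hfe⟩ := hf y hy
        have hyS := (Finset.mem_bipartiteBelow _ |>.1 hy).1
        obtain ⟨-, -, r⟩ := hPQ y hyS
        refine Finset.mem_coe.2 (Finset.mem_filter.2 ⟨hfA, ?_⟩)
        have hexp : x ^ (P y * f y * Q y₀) = x ^ (P y₀ * p₀ * Q y) := by
          calc x ^ (P y * f y * Q y₀) = ((y ^ f y) ^ Q y) ^ Q y₀ := by
                rw [pow_mul, pow_mul, r, ← pow_mul y, ← pow_mul y (f y), mul_comm (Q y)]
            _ = ((y₀ ^ p₀) ^ Q y₀) ^ Q y := by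
                rw [hfe, e₀, ← pow_mul, ← pow_mul, mul_comm]
            _ = x ^ (P y₀ * p₀ * Q y) := by
                rw [pow_mul x, pow_mul x, r₀, ← pow_mul y₀, ← pow_mul y₀ (Q y₀), mul_comm (Q y₀)]
        have hexp' := pow_right_injective_of_not_isOfFinOrder hx hexp
        have hdvd : f y ∣ P y₀ * p₀ * Q y := by
          rw [← hexp']
          exact Dvd.intro_left (P y) rfl |>.mul_right _
        exact ((hA _ hfA).dvd_mul.1 hdvd).resolve_right hfd
      · intro y hy y' hy' hff
        obtain ⟨hfA, hfd, hfe⟩ := hf y hy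
        obtain ⟨-, hfd', hfe'⟩ := hf y' hy'
        obtain ⟨-, -, r⟩ := hPQ y (Finset.mem_bipartiteBelow _ |>.1 hy).1
        obtain ⟨-, -, r'⟩ := hPQ y' (Finset.mem_bipartiteBelow _ |>.1 hy').1
        rw [← hff] at hfd' hfe'
        have hyy : y ^ f y = y' ^ f y := hfe.trans hfe'.symm
        have hdiv : x ^ P y' = y ^ Q y' := by
          refine pow_eq_of_pow_mul_eq hx (hA _ hfA) hfd r ?_
          rw [pow_mul, r', ← pow_mul, mul_comm, pow_mul, ← hyy, ← pow_mul]
        exact eq_of_pow_eq_of_coprime_s8 ((Nat.Prime.coprime_iff_not_dvd (hA _ hfA)).2 hfd')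
          hyy (hdiv.symm.trans r')

/-- An element outside `C_k(x)` has at most `k + 1` powers in `O(C_k(x))`. -/
theorem card_filter_pow_mem_powImage_le {G : Type*} [CommGroup G] [DecidableEq G] {A : Finset ℕ}
    (hA : ∀ p ∈ A, p.Prime) {x : G} (hx : ¬ IsOfFinOrder x) {k : ℕ} {S : Finset G}
    (hrel : ∀ y ∈ S, PowRelated A k x y) {y : G} (hy : ¬ PowRelated A k x y) :
    (A.filter fun p => y ^ p ∈ powImage A S).card ≤ k + 1 := by
  classical
  rcases (A.filter fun p => y ^ p ∈ powImage A S).eq_empty_or_nonempty with h | ⟨p₀, h₀⟩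
  · simp [h]
  · rw [Finset.mem_filter, mem_powImage] at h₀
    obtain ⟨hp₀, z₀, hz₀, q₀, hq₀, e₀⟩ := h₀
    obtain ⟨P₀, Q₀, hP₀, hQ₀, r₀⟩ := (hrel z₀ hz₀).step hp₀ hq₀ e₀.symm
    refine le_trans (Finset.card_le_card ?_) (hQ₀.card_dvd_le hA)
    intro p hp
    rw [Finset.mem_filter, mem_powImage] at hp
    obtain ⟨hpA, z, hz, q, hq, e⟩ := hp
    refine Finset.mem_filter.2 ⟨hpA, ?_⟩
    by_contra hd
    obtain ⟨P, Q, hP, hQ, r⟩ := hrel z hz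
    have hr : x ^ (P * q) = y ^ (Q * p) := by
      rw [pow_mul, r, ← pow_mul, mul_comm, pow_mul, e, ← pow_mul, mul_comm]
    have hexp : x ^ (P₀ * (Q * p)) = x ^ (P * q * Q₀) := by
      rw [pow_mul, r₀, pow_mul x, hr, ← pow_mul, ← pow_mul, mul_comm]
    have hexp' := pow_right_injective_of_not_isOfFinOrder hx hexp
    have hdvd : p ∣ P * q * Q₀ := by
      rw [← hexp', ← mul_assoc]
      exact Dvd.intro_left _ rfl
    obtain ⟨m, hm, hmp⟩ := (hP.mul hq).exists_of_dvd hA hpA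
      (((hA p hpA).dvd_mul.1 hdvd).resolve_right hd)
    rw [hmp] at hr
    exact hy ⟨m, Q, hm, hQ, pow_eq_of_pow_mul_eq hx (hA p hpA) hd r₀ hr⟩

/-- Some `C_k(x) ∩ E` with `k ≤ ℓ` has many powers that are not powers of the other elements of
`E`. -/
theorem exists_card_le_card_powImage_sdiff {G : Type*} [CommGroup G] [DecidableEq G]
    {A : Finset ℕ} (hA : ∀ p ∈ A, p.Prime) {E : Finset G} (hE : ∀ y ∈ E, ¬ IsOfFinOrder y)
    {ℓ : ℕ} (hℓ : ℓ + 2 ≤ A.card)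
    (hcard : ((powImage A E).card : ℝ) ≤
      (A.card.choose (ℓ + 2) : ℝ) / (2 ^ (ℓ + 1) * (ℓ + 1).factorial))
    {x : G} (hxE : x ∈ E) :
    ∃ S ⊆ E, x ∈ S ∧ (∀ y ∈ S, PowRelated A ℓ x y) ∧
      ((A.card : ℝ) - ℓ) / (2 * (ℓ + 1)) * S.card ≤
        ((powImage A S \ powImage A (E \ S)).card : ℝ) := by
  classical
  have hAne : A.Nonempty := Finset.card_pos.1 (by omega)
  have hx := hE x hxE
  by_contra! hcon
  set C : ℕ → Finset G := fun k => E.filter fun y => PowRelated A k x y with hC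
  have hCE : ∀ k, C k ⊆ E := fun k => Finset.filter_subset _ _
  have hCrel : ∀ k, ∀ y ∈ C k, PowRelated A k x y := fun k y hy => (Finset.mem_filter.1 hy).2
  have hO : ∀ k ≤ ℓ + 1, ((C k).card : ℝ) * ((A.card : ℝ) - k) ≤
      ((powImage A (C k)).card : ℝ) * (k + 1) := by
    intro k hk
    have := card_mul_le_card_powImage hA hx (fun y hy => hE y (hCE k hy)) (hCrel k)
    rw [← Nat.cast_sub (by omega)]
    exact_mod_cast this
  have hgrow : ∀ k ≤ ℓ, ((C k).card : ℝ) * ((A.card : ℝ) - k) <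
      ((C (k + 1)).card : ℝ) * (2 * (k + 1) ^ 2) := by
    intro k hk
    have hpriv := hcon (C k) (hCE k)
      (Finset.mem_filter.2 ⟨hxE, (PowRelated.refl x).mono hAne (Nat.zero_le k)⟩)
      (fun y hy => (hCrel k y hy).mono hAne hk)
    have hsub : powImage A (C k) ∩ powImage A (E \ C k) ⊆
        (C (k + 1) \ C k).biUnion fun y =>
          (A.filter fun p => y ^ p ∈ powImage A (C k)).image fun p => y ^ p := by
      intro z hz
      obtain ⟨hz1, hz2⟩ := Finset.mem_inter.1 hz
      obtain ⟨y, hy, p, hp, rfl⟩ := mem_powImage.1 hz2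
      obtain ⟨w, hw, q, hq, e⟩ := mem_powImage.1 hz1
      obtain ⟨hyE, hyC⟩ := Finset.mem_sdiff.1 hy
      refine Finset.mem_biUnion.2 ⟨y, Finset.mem_sdiff.2 ⟨Finset.mem_filter.2 ⟨hyE, ?_⟩, hyC⟩,
        Finset.mem_image.2 ⟨p, Finset.mem_filter.2 ⟨hp, hz1⟩, rfl⟩⟩
      exact (hCrel k w hw).step hp hq e.symm
    have hshared : (powImage A (C k) ∩ powImage A (E \ C k)).card ≤
        (C (k + 1)).card * (k + 1) := by
      refine (Finset.card_le_card hsub).trans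
        ((Finset.card_biUnion_le_card_mul _ _ (k + 1) ?_).trans
          (Nat.mul_le_mul_right _ (Finset.card_le_card Finset.sdiff_subset)))
      intro y hy
      obtain ⟨hy1, hy2⟩ := Finset.mem_sdiff.1 hy
      refine Finset.card_image_le.trans (card_filter_pow_mem_powImage_le hA hx (hCrel k) ?_)
      exact fun h => hy2 (Finset.mem_filter.2 ⟨hCE _ hy1, h⟩)
    have hsum : ((powImage A (C k)).card : ℝ) =
        ((powImage A (C k) \ powImage A (E \ C k)).card : ℝ) +
        ((powImage A (C k) ∩ powImage A (E \ C k)).card : ℝ) := by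
      exact_mod_cast (Finset.card_sdiff_add_card_inter _ _).symm
    have hshared' : ((powImage A (C k) ∩ powImage A (E \ C k)).card : ℝ) ≤
        ((C (k + 1)).card : ℝ) * (k + 1) := by exact_mod_cast hshared
    have hk' : (k : ℝ) ≤ ℓ := by exact_mod_cast hk
    have hn' : (ℓ : ℝ) + 2 ≤ A.card := by exact_mod_cast hℓ
    have hmono : ((A.card : ℝ) - ℓ) / (2 * (ℓ + 1)) ≤ ((A.card : ℝ) - k) / (2 * (k + 1)) := by
      gcongr
      linarith
    have hpriv' : ((powImage A (C k) \ powImage A (E \ C k)).card : ℝ) * (2 * (k + 1)) <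
        ((A.card : ℝ) - k) * (C k).card := by
      have h1 := hpriv.trans_le (mul_le_mul_of_nonneg_right hmono (Nat.cast_nonneg _))
      rw [div_mul_eq_mul_div, lt_div_iff₀ (by positivity)] at h1
      exact h1
    have hOk := hO k (by omega)
    nlinarith [mul_le_mul_of_nonneg_right hshared' (by positivity : (0 : ℝ) ≤ 2 * ((k : ℝ) + 1))]
  have hchoose : ∀ k ≤ A.card, (A.card.choose (k + 1) : ℝ) * (k + 1) =
      A.card.choose k * ((A.card : ℝ) - k) := by
    intro k hk
    rw [← Nat.cast_sub hk]
    exact_mod_cast Nat.choose_succ_right_eq A.card k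
  have hlower : ∀ k ≤ ℓ + 1, (A.card.choose k : ℝ) ≤ (C k).card * (2 ^ k * k.factorial) ∧
      (k ≠ 0 → (A.card.choose k : ℝ) < (C k).card * (2 ^ k * k.factorial)) := by
    intro k
    induction k with
    | zero =>
      intro _
      have : 1 ≤ (C 0).card :=
        Finset.card_pos.2 ⟨x, Finset.mem_filter.2 ⟨hxE, PowRelated.refl x⟩⟩
      simpa using this
    | succ k ih =>
      intro hk
      have h1 := (ih (by omega)).1
      have h2 := hgrow k (by omega)
      have h3 := hchoose k (by omega)
      have hpos : (0 : ℝ) < (A.card : ℝ) - k := by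
        have : ((k + 1 : ℕ) : ℝ) ≤ A.card := by exact_mod_cast (by omega : k + 1 ≤ A.card)
        push_cast at this
        linarith
      have key : (A.card.choose (k + 1) : ℝ) <
          (C (k + 1)).card * (2 ^ (k + 1) * (k + 1).factorial) := by
        refine lt_of_mul_lt_mul_right (a := (k : ℝ) + 1) ?_ (by positivity)
        calc (A.card.choose (k + 1) : ℝ) * (k + 1)
            = A.card.choose k * ((A.card : ℝ) - k) := h3
          _ ≤ (C k).card * (2 ^ k * k.factorial) * ((A.card : ℝ) - k) := by gcongr
          _ = (C k).card * ((A.card : ℝ) - k) * (2 ^ k * k.factorial) := by ring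
          _ < (C (k + 1)).card * (2 * (k + 1) ^ 2) * (2 ^ k * k.factorial) := by gcongr
          _ = _ := by rw [Nat.factorial_succ]; push_cast; ring
      exact ⟨key.le, fun _ => key⟩
  have h1 := (hlower (ℓ + 1) le_rfl).2 (by omega)
  have h2 := hO (ℓ + 1) le_rfl
  have h3 := hchoose (ℓ + 1) (by omega)
  have h4 : ((powImage A (C (ℓ + 1))).card : ℝ) ≤ (powImage A E).card := by
    exact_mod_cast Finset.card_le_card (Finset.biUnion_subset_biUnion_of_subset_left _ (hCE _))
  rw [le_div_iff₀ (by positivity)] at hcard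
  have hpos : (0 : ℝ) < (A.card : ℝ) - (ℓ + 1 : ℕ) := by
    have : ((ℓ + 2 : ℕ) : ℝ) ≤ A.card := by exact_mod_cast hℓ
    push_cast at this ⊢
    linarith
  have h5 : (A.card.choose (ℓ + 2) : ℝ) * ((ℓ + 1 : ℕ) + 1) < A.card.choose (ℓ + 2) *
      ((ℓ + 1 : ℕ) + 1) := by
    calc (A.card.choose (ℓ + 2) : ℝ) * ((ℓ + 1 : ℕ) + 1)
        = A.card.choose (ℓ + 1) * ((A.card : ℝ) - (ℓ + 1 : ℕ)) := h3
      _ < (C (ℓ + 1)).card * (2 ^ (ℓ + 1) * (ℓ + 1).factorial) *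
          ((A.card : ℝ) - (ℓ + 1 : ℕ)) := by gcongr
      _ = (C (ℓ + 1)).card * ((A.card : ℝ) - (ℓ + 1 : ℕ)) *
          (2 ^ (ℓ + 1) * (ℓ + 1).factorial) := by ring
      _ ≤ (powImage A (C (ℓ + 1))).card * ((ℓ + 1 : ℕ) + 1) *
          (2 ^ (ℓ + 1) * (ℓ + 1).factorial) := by gcongr
      _ ≤ (powImage A E).card * ((ℓ + 1 : ℕ) + 1) *
          (2 ^ (ℓ + 1) * (ℓ + 1).factorial) := by gcongr
      _ = (powImage A E).card * (2 ^ (ℓ + 1) * (ℓ + 1).factorial) * ((ℓ + 1 : ℕ) + 1) := by ring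
      _ ≤ A.card.choose (ℓ + 2) * ((ℓ + 1 : ℕ) + 1) := by gcongr
  exact lt_irrefl _ h5

/-- Peeling off one subset of some `C_ℓ(x)` at a time partitions `E`, with disjoint sets of powers. -/
theorem exists_partition {G : Type*} [CommGroup G] [DecidableEq G]
    {A : Finset ℕ} (hA : ∀ p ∈ A, p.Prime) {ℓ : ℕ} (hℓ : ℓ + 2 ≤ A.card)
    (E : Finset G) (hE : ∀ y ∈ E, ¬ IsOfFinOrder y)
    (hcard : ((powImage A E).card : ℝ) ≤
      (A.card.choose (ℓ + 2) : ℝ) / (2 ^ (ℓ + 1) * (ℓ + 1).factorial)) :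
    ∃ (r : ℕ) (x : Fin r → G) (EP FP : Fin r → Finset G),
      (∀ i, x i ∈ E) ∧
      (∀ i j, i ≠ j → Disjoint (EP i) (EP j)) ∧
      (∀ i j, i ≠ j → Disjoint (FP i) (FP j)) ∧
      (∀ y, y ∈ E ↔ ∃ i, y ∈ EP i) ∧
      ∀ i, (∀ y ∈ EP i, PowRelated A ℓ (x i) y) ∧
        FP i ⊆ powImage A (EP i) ∧
        ((A.card : ℝ) - ℓ) / (2 * (ℓ + 1)) * (EP i).card ≤ ((FP i).card : ℝ) := by
  induction E using Finset.strongInduction with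
  | H E ih =>
    rcases E.eq_empty_or_nonempty with rfl | ⟨x, hx⟩
    · exact ⟨0, Fin.elim0, Fin.elim0, Fin.elim0, by simp⟩
    obtain ⟨S, hSE, hxS, hrel, hS⟩ := exists_card_le_card_powImage_sdiff hA hE hℓ hcard hx
    have hsub : powImage A (E \ S) ⊆ powImage A E :=
      Finset.biUnion_subset_biUnion_of_subset_left _ Finset.sdiff_subset
    obtain ⟨r, xs, EP, FP, hxs, hEP, hFP, hun, hprop⟩ :=
      ih (E \ S) (Finset.sdiff_ssubset hSE ⟨x, hxS⟩)
        (fun y hy => hE y (Finset.sdiff_subset hy))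
        ((Nat.cast_le.2 (Finset.card_le_card hsub)).trans hcard)
    have hEPsub : ∀ i, EP i ⊆ E \ S := fun i y hy => (hun y).2 ⟨i, hy⟩
    have hE1 : ∀ i, Disjoint S (EP i) := fun i =>
      Finset.disjoint_sdiff.mono_right (hEPsub i)
    have hF1 : ∀ i, Disjoint (powImage A S \ powImage A (E \ S)) (FP i) := fun i =>
      Finset.sdiff_disjoint.mono_right ((hprop i).2.1.trans
        (Finset.biUnion_subset_biUnion_of_subset_left _ (hEPsub i)))
    refine ⟨r + 1, Fin.cons x xs, Fin.cons S EP,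
      Fin.cons (powImage A S \ powImage A (E \ S)) FP, ?_, ?_, ?_, ?_, ?_⟩
    · intro i
      refine Fin.cases hx (fun i => Finset.sdiff_subset (hxs i)) i
    · intro i j
      refine Fin.cases ?_ (fun i => ?_) i <;> refine Fin.cases ?_ (fun j => ?_) j
      · simp
      · exact fun _ => by simpa using hE1 j
      · simpa using (hE1 i).symm
      · simpa using hEP i j
    · intro i j
      refine Fin.cases ?_ (fun i => ?_) i <;> refine Fin.cases ?_ (fun j => ?_) j
      · simp
      · exact fun _ => by simpa using hF1 j
      · simpa using (hF1 i).symm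
      · simpa using hFP i j
    · intro y
      rw [Fin.exists_fin_succ]
      simp only [Fin.cons_zero, Fin.cons_succ, ← hun, Finset.mem_sdiff]
      have := @hSE y
      tauto
    · intro i
      refine Fin.cases ?_ (fun i => ?_) i
      · exact ⟨hrel, Finset.sdiff_subset, hS⟩
      · exact hprop i

/-- combinatorial estimate for an intersection in an abelian group. -/
theorem stmt_8 {G : Type*} [CommGroup G] [DecidableEq G]
    (A : Finset ℕ) (hAprime : ∀ p ∈ A, Nat.Prime p) (hA2 : 2 ≤ A.card)
    (E F : Finset G) (hE : E.Nonempty) (hF : F.Nonempty)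
    (hOE : ∀ x ∈ E, ∀ p ∈ A, x ^ p ∈ F)
    (hEtor : ∀ x ∈ E, ¬ IsOfFinOrder x)
    (ℓ : ℕ) (hℓ : ℓ + 2 ≤ A.card)
    (hcard : (F.card : ℝ) ≤
      (A.card.choose (ℓ + 2) : ℝ) / (2 ^ (ℓ + 1) * (ℓ + 1).factorial)) :
    ∃ (r : ℕ) (x : Fin r → G) (EP : Fin r → Finset G) (FP : Fin (r + 1) → Finset G),
      1 ≤ r ∧ (∀ i, x i ∈ E) ∧
      (∀ i j, i ≠ j → Disjoint (EP i) (EP j)) ∧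
      (∀ i j, i ≠ j → Disjoint (FP i) (FP j)) ∧
      E = Finset.univ.biUnion EP ∧
      F = Finset.univ.biUnion FP ∧
      ∀ i : Fin r,
        -- a) E_i ⊆ C_ℓ(x_i)
        (∀ y ∈ EP i, ∃ p q : Fin ℓ → ℕ, (∀ k, p k ∈ A) ∧ (∀ k, q k ∈ A) ∧
          (x i) ^ (∏ k, p k) = y ^ (∏ k, q k)) ∧
        -- b) F_i ⊆ O(E_i)
        (∀ y ∈ FP i.castSucc, ∃ z ∈ EP i, ∃ p ∈ A, y = z ^ p) ∧
        -- c) |F_i| ≥ ((|A| - ℓ)/(2(ℓ+1)))·|E_i|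
        (((A.card : ℝ) - ℓ) / (2 * (ℓ + 1)) * (EP i).card ≤ ((FP i.castSucc).card : ℝ)) := by
  have hsub : powImage A E ⊆ F := by
    intro z hz
    obtain ⟨y, hy, p, hp, rfl⟩ := mem_powImage.1 hz
    exact hOE y hy p hp
  obtain ⟨r, x, EP, FP, hx, hEP, hFP, hun, hprop⟩ := exists_partition hAprime hℓ E hEtor
    ((Nat.cast_le.2 (Finset.card_le_card hsub)).trans hcard)
  have hFsub : ∀ i, FP i ⊆ F := fun i => (hprop i).2.1.trans
    ((Finset.biUnion_subset_biUnion_of_subset_left _ fun y hy => (hun y).2 ⟨i, hy⟩).trans hsub)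
  have hdisj : ∀ i, Disjoint (FP i) (F \ Finset.univ.biUnion FP) := fun i =>
    Finset.disjoint_sdiff.mono_left (Finset.subset_biUnion_of_mem FP (Finset.mem_univ i))
  refine ⟨r, x, EP, Fin.snoc FP (F \ Finset.univ.biUnion FP), ?_, hx, hEP, ?_, ?_, ?_, ?_⟩
  · obtain ⟨y, hy⟩ := hE
    obtain ⟨i, -⟩ := (hun y).1 hy
    exact i.pos
  · intro i j
    refine Fin.lastCases ?_ (fun i => ?_) i <;> refine Fin.lastCases ?_ (fun j => ?_) j
    · simp
    · simpa using fun _ => (hdisj j).symm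
    · simpa using hdisj i
    · simpa using hFP i j
  · ext y
    simp [hun]
  · ext z
    simp only [Finset.mem_biUnion, Finset.mem_univ, true_and, Fin.exists_fin_succ',
      Fin.snoc_castSucc, Fin.snoc_last, Finset.mem_sdiff]
    have : (∃ i, z ∈ FP i) → z ∈ F := fun ⟨i, hi⟩ => hFsub i hi
    tauto
  · intro i
    obtain ⟨h1, h2, h3⟩ := hprop i
    simp only [Fin.snoc_castSucc]
    refine ⟨fun y hy => ?_, fun z hz => ?_, h3⟩
    · obtain ⟨P, Q, hP, hQ, e⟩ := h1 y hy
      obtain ⟨p, hp, rfl⟩ := hP.exists_fin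
      obtain ⟨q, hq, rfl⟩ := hQ.exists_fin
      exact ⟨p, q, hp, hq, e⟩
    · obtain ⟨y, hy, p, hp, rfl⟩ := mem_powImage.1 (h2 hz)
      exact ⟨y, hy, p, hp, rfl⟩
end

section
/- Let A and B be finite nonempty sets, let κ₁ and κ₂ be positive real numbers, and let φ : A × B → [0, κ₁] be any function with values in the interval [0, κ₁]. Suppose that for every pair of distinct elements a₁, a₂ of A one has ∑_{b∈B} min{φ(a₁,b), φ(a₂,b)} ≤ κ₂. Then ∑_{a∈A} ∑_{b∈B} φ(a,b) ≤ max{ |A|·√(2|B|·κ₁·κ₂), 2|B|·κ₁ }. -/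
/-- For values in `[0, κ]`, the square of the sum is at most `κ` times the sum of the pairwise
minima. -/
lemma sq_sum_le_mul_sum_sum_min {α : Type*} (A : Finset α) {κ : ℝ} {x : α → ℝ}
    (hx : ∀ a ∈ A, x a ∈ Set.Icc (0 : ℝ) κ) :
    (∑ a ∈ A, x a) ^ 2 ≤ κ * ∑ a₁ ∈ A, ∑ a₂ ∈ A, min (x a₁) (x a₂) := by
  rw [sq, Finset.sum_mul_sum, Finset.mul_sum]
  refine Finset.sum_le_sum fun a₁ h₁ => ?_
  rw [Finset.mul_sum]
  refine Finset.sum_le_sum fun a₂ h₂ => ?_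
  obtain ⟨h₁0, h₁κ⟩ := hx a₁ h₁
  obtain ⟨h₂0, h₂κ⟩ := hx a₂ h₂
  rw [← max_mul_min]
  exact mul_le_mul_of_nonneg_right (max_le h₁κ h₂κ) (le_min h₁0 h₂0)

/-- If `f` is at most `c` off the diagonal of `A ×ˢ A`, its sum is at most its trace plus
`|A|² c`. -/
lemma sum_sum_le_sum_diag_add {α : Type*} (A : Finset α) {c : ℝ} (hc : 0 ≤ c)
    {f : α → α → ℝ}
    (hf : ∀ a₁ ∈ A, ∀ a₂ ∈ A, a₁ ≠ a₂ → f a₁ a₂ ≤ c) :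
    ∑ a₁ ∈ A, ∑ a₂ ∈ A, f a₁ a₂ ≤ ∑ a ∈ A, f a a + (A.card : ℝ) ^ 2 * c := by
  classical
  calc ∑ a₁ ∈ A, ∑ a₂ ∈ A, f a₁ a₂
      ≤ ∑ a₁ ∈ A, ∑ a₂ ∈ A, ((if a₁ = a₂ then f a₁ a₁ else 0) + c) := by
        refine Finset.sum_le_sum fun a₁ h₁ => Finset.sum_le_sum fun a₂ h₂ => ?_
        split_ifs with h
        · subst h
          linarith
        · simpa using hf a₁ h₁ a₂ h₂ h
    _ = ∑ a ∈ A, f a a + (A.card : ℝ) ^ 2 * c := by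
        simp only [Finset.sum_add_distrib, Finset.sum_ite_eq, Finset.sum_const, nsmul_eq_mul]
        congr 1
        · exact Finset.sum_congr rfl fun a ha => if_pos ha
        · ring

/-- Proposition related to Zarankiewicz's problem. -/
theorem stmt_13 {α γ : Type*} (A : Finset α) (B : Finset γ)
    (hA : A.Nonempty) (hB : B.Nonempty)
    (κ₁ κ₂ : ℝ) (hκ₁ : 0 < κ₁) (hκ₂ : 0 < κ₂)
    (φ : α → γ → ℝ) (hφ : ∀ a ∈ A, ∀ b ∈ B, φ a b ∈ Set.Icc (0 : ℝ) κ₁)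
    (hmin : ∀ a₁ ∈ A, ∀ a₂ ∈ A, a₁ ≠ a₂ →
      ∑ b ∈ B, min (φ a₁ b) (φ a₂ b) ≤ κ₂) :
    ∑ a ∈ A, ∑ b ∈ B, φ a b ≤
      max ((A.card : ℝ) * Real.sqrt (2 * B.card * κ₁ * κ₂)) (2 * B.card * κ₁) := by
  have key : (∑ a ∈ A, ∑ b ∈ B, φ a b) ^ 2 ≤
      B.card * κ₁ * (∑ a ∈ A, ∑ b ∈ B, φ a b + (A.card : ℝ) ^ 2 * κ₂) := by
    calc (∑ a ∈ A, ∑ b ∈ B, φ a b) ^ 2 = (∑ b ∈ B, ∑ a ∈ A, φ a b) ^ 2 := by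
          rw [Finset.sum_comm]
      _ ≤ B.card * ∑ b ∈ B, (∑ a ∈ A, φ a b) ^ 2 := sq_sum_le_card_mul_sum_sq
      _ ≤ B.card * ∑ b ∈ B, κ₁ * ∑ a₁ ∈ A, ∑ a₂ ∈ A, min (φ a₁ b) (φ a₂ b) := by
          gcongr with b hb
          exact sq_sum_le_mul_sum_sum_min A fun a ha => hφ a ha b hb
      _ = B.card * κ₁ * ∑ a₁ ∈ A, ∑ a₂ ∈ A, ∑ b ∈ B, min (φ a₁ b) (φ a₂ b) := by
          rw [← Finset.mul_sum, mul_assoc, Finset.sum_comm]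
          simp_rw [Finset.sum_comm (s := B)]
      _ ≤ B.card * κ₁ * (∑ a ∈ A, ∑ b ∈ B, φ a b + (A.card : ℝ) ^ 2 * κ₂) := by
          gcongr
          simpa only [min_self] using sum_sum_le_sum_diag_add A hκ₂.le
            (f := fun a₁ a₂ => ∑ b ∈ B, min (φ a₁ b) (φ a₂ b))
            hmin
  generalize ∑ a ∈ A, ∑ b ∈ B, φ a b = S at key ⊢
  by_cases hS : S ≤ 2 * B.card * κ₁
  · exact le_max_of_le_right hS
  · rw [not_le] at hS
    apply le_max_of_le_left
    have hpos : 0 < S := hS.trans_le' (by positivity)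
    refine (sq_le_sq₀ hpos.le (by positivity)).1 ?_
    rw [mul_pow, Real.sq_sqrt (by positivity)]
    nlinarith [mul_lt_mul_of_pos_right hS hpos]
end

section
/- Let φ : ℤ[T] → [0,∞) be a multiplicative function (i.e. φ(FG) = φ(F)·φ(G) for all F, G ∈ ℤ[T]), let δ, d, Y be positive real numbers with δ < 1 and e^d ≤ Y, and let t be a positive integer. Suppose there exists a nonzero polynomial Q₁ ∈ ℤ[T] of degree at most d and height at most Y for which Q = gcd{ Q₁^[j] : 0 ≤ j < t } (computed in ℤ[T]) satisfies φ(Q) ≤ δ. Then there exists a primary polynomial S ∈ ℤ[T] with deg(S) ≤ d/t, H(S) ≤ Y^{2/t}, and φ(S) ≤ δ^{1/(6t)}. -/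
/-- A nonzero polynomial of `ℤ[T]` is primary if it is a power of an irreducible element. -/
def IsPrimary (S : Polynomial ℤ) : Prop :=
  ∃ (R : Polynomial ℤ) (k : ℕ), Irreducible R ∧ 1 ≤ k ∧ S = R ^ k

open Polynomial in
/-- An irreducible polynomial of positive degree dividing the first `t` derivatives of `F`,
starting with `F` itself, divides `F` to the order `t`. -/
theorem pow_dvd_of_dvd_iterate_derivative {R : ℤ[X]} (hR : Irreducible R)
    (hdeg : R.natDegree ≠ 0) (t : ℕ) (F : ℤ[X]) (h : ∀ j < t, R ∣ derivative^[j] F) :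
    R ^ t ∣ F := by
  induction t generalizing F with
  | zero => simp
  | succ t ih =>
    have hF' : R ^ t ∣ derivative F := ih _ fun j hj => by
      simpa [Function.iterate_succ_apply] using h (j + 1) (by lia)
    by_cases hF : F = 0
    · simp [hF]
    have hp : Prime R := hR.prime
    obtain ⟨A, hFA, hA⟩ :=
      (FiniteMultiplicity.of_not_isUnit hR.not_isUnit hF).exists_eq_pow_mul_and_not_dvd
    generalize multiplicity R F = m at hFA
    rcases Nat.lt_or_ge t m with hm | hm
    · exact hFA ▸ Dvd.dvd.mul_right (pow_dvd_pow R hm) A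
    exfalso
    have h0 : R ∣ F := by simpa using h 0 (by lia)
    obtain _ | m := m
    · exact hA (by simpa [hFA] using h0)
    have h1 : R ^ (m + 1) ∣ derivative F := (pow_dvd_pow R hm).trans hF'
    rw [hFA, derivative_mul, derivative_pow_succ, dvd_add_left (dvd_mul_right _ _)] at h1
    have h2 : R ^ m * R ∣ R ^ m * (C ((m : ℤ) + 1) * derivative R * A) := by
      have h : R ^ m * (C ((m : ℤ) + 1) * derivative R * A) =
          C ((m : ℤ) + 1) * R ^ m * derivative R * A := by ac_rfl
      rwa [h, ← pow_succ]
    have h3 := (mul_dvd_mul_iff_left (pow_ne_zero m hp.ne_zero)).1 h2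
    rcases hp.dvd_or_dvd h3 with h4 | h4
    · rcases hp.dvd_or_dvd h4 with h5 | h5
      · have := natDegree_le_of_dvd h5 (C_ne_zero.2 (by lia))
        rw [natDegree_C] at this
        lia
      · have := natDegree_le_of_dvd h5 (fun h => hdeg (derivative_eq_zero.1 h))
        have := natDegree_derivative_lt hdeg
        lia
    · exact hA h4

open Polynomial in
/-- The Mahler measure of an integer polynomial. -/
noncomputable def intMahler (P : ℤ[X]) : ℝ := (P.map (Int.castRingHom ℂ)).mahlerMeasure

open Polynomial in
theorem intMahler_mul (P Q : ℤ[X]) : intMahler (P * Q) = intMahler P * intMahler Q := by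
  simp [intMahler, mahlerMeasure_mul]

open Polynomial in
theorem one_le_intMahler {P : ℤ[X]} (hP : P ≠ 0) : 1 ≤ intMahler P :=
  one_le_mahlerMeasure_of_ne_zero hP

open Polynomial in
theorem intMahler_pow (P : ℤ[X]) (n : ℕ) : intMahler (P ^ n) = intMahler P ^ n := by
  induction n with
  | zero => simp [intMahler]
  | succ n ih => rw [pow_succ, pow_succ, intMahler_mul, ih]

open Polynomial in
theorem intMahler_le_of_dvd {P Q : ℤ[X]} (h : P ∣ Q) (hQ : Q ≠ 0) :
    intMahler P ≤ intMahler Q := by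
  obtain ⟨A, rfl⟩ := h
  have h1 := one_le_intMahler (left_ne_zero_of_mul hQ)
  have h2 := one_le_intMahler (right_ne_zero_of_mul hQ)
  rw [intMahler_mul]
  nlinarith

open Polynomial in
theorem content_pos {P : ℤ[X]} (hP : P ≠ 0) : 0 < P.content :=
  lt_of_le_of_ne (Int.nonneg_of_normalize_eq_self normalize_content)
    (Ne.symm (content_eq_zero_iff.not.2 hP))

open Polynomial in
theorem intMahler_primPart_le {P : ℤ[X]} (hP : P ≠ 0) :
    intMahler P.primPart ≤ (P.natDegree + 1) * intHeight P := by
  have hc : (0 : ℝ) < (P.content : ℤ) := by exact_mod_cast content_pos hP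
  have h1 : intMahler P = P.content * intMahler P.primPart := by
    conv_lhs => rw [P.eq_C_content_mul_primPart, intMahler_mul]
    congr 1
    rw [intMahler, map_C, mahlerMeasure_const, eq_intCast, Complex.norm_intCast, abs_of_pos hc]
  have h2 : intMahler P ≤ (P.natDegree + 1) *
      (((Finset.range (P.natDegree + 1)).sup fun i => (P.coeff i).natAbs : ℕ) : ℝ) := by
    refine (mahlerMeasure_le_sum_norm_coeff _).trans ?_
    rw [sum_over_range _ (by simp),
      natDegree_map_eq_of_injective (Int.castRingHom ℂ).injective_int]
    refine (Finset.sum_le_card_nsmul _ _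
      (((Finset.range (P.natDegree + 1)).sup fun i => (P.coeff i).natAbs : ℕ) : ℝ)
      fun i hi => ?_).trans_eq (by simp)
    have := Finset.le_sup (f := fun i => (P.coeff i).natAbs) hi
    rw [coeff_map, eq_intCast, Complex.norm_intCast, ← Int.cast_abs, Int.abs_eq_natAbs]
    exact_mod_cast this
  rw [intHeight, mul_div_assoc', le_div_iff₀ hc, mul_comm, ← h1]
  exact h2

theorem choose_le_two_pow_pred {n : ℕ} (hn : n ≠ 0) (k : ℕ) : n.choose k ≤ 2 ^ (n - 1) := by
  obtain ⟨n, rfl⟩ := Nat.exists_eq_succ_of_ne_zero hn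
  cases k with
  | zero => simpa using Nat.one_le_two_pow
  | succ k =>
    rw [Nat.succ_eq_add_one, Nat.choose_succ_succ, Nat.add_sub_cancel, ← Nat.sum_range_choose]
    rcases Nat.lt_or_ge k n with hk | hk
    · have : ({k, k + 1} : Finset ℕ) ⊆ Finset.range (n + 1) := by
        intro x hx
        simp only [Finset.mem_insert, Finset.mem_singleton] at hx
        simp only [Finset.mem_range]
        lia
      refine le_trans ?_ (Finset.sum_le_sum_of_subset this)
      rw [Finset.sum_pair (by lia)]
    · rw [Nat.choose_eq_zero_of_lt (by lia : n < k + 1), add_zero]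
      rcases hk.eq_or_lt with rfl | hk
      · exact Finset.single_le_sum (f := fun m => n.choose m) (fun _ _ => Nat.zero_le _)
          (by simp)
      · simp [Nat.choose_eq_zero_of_lt hk]

open Polynomial in
theorem intHeight_le_two_pow_mul_intMahler {P : ℤ[X]} (hP : P.natDegree ≠ 0) :
    intHeight P ≤ 2 ^ (P.natDegree - 1) * intMahler P := by
  have hP0 : P ≠ 0 := fun h => hP (by simp [h])
  have hc : (1 : ℝ) ≤ (P.content : ℤ) := by exact_mod_cast content_pos hP0
  refine (div_le_self (Nat.cast_nonneg _) hc).trans ?_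
  obtain ⟨i, -, hi⟩ := Finset.exists_mem_eq_sup (Finset.range (P.natDegree + 1)) (by simp)
    fun i => (P.coeff i).natAbs
  rw [hi]
  have h1 := norm_coeff_le_choose_mul_mahlerMeasure i (P.map (Int.castRingHom ℂ))
  rw [natDegree_map_eq_of_injective (Int.castRingHom ℂ).injective_int, coeff_map, eq_intCast,
    Complex.norm_intCast] at h1
  rw [Nat.cast_natAbs, Int.cast_abs]
  refine h1.trans ?_
  have h2 : (P.natDegree.choose i : ℝ) ≤ 2 ^ (P.natDegree - 1) := by
    exact_mod_cast choose_le_two_pow_pred hP i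
  exact mul_le_mul_of_nonneg_right h2 (zero_le_one.trans (one_le_intMahler hP0))

theorem two_pow_mul_le_exp {D : ℕ} (hD : D ≠ 0) :
    (2 : ℝ) ^ (D - 1) * (D + 1) ≤ Real.exp D := by
  have he := Real.exp_one_gt_d9
  rw [← mul_one (D : ℝ), Real.exp_nat_mul]
  induction D with
  | zero => exact absurd rfl hD
  | succ n ih =>
    rcases Nat.lt_or_ge n 2 with hn | hn
    · interval_cases n
      · norm_num; linarith
      · norm_num [pow_two]; nlinarith
    · obtain ⟨m, rfl⟩ : ∃ m, n = m + 2 := ⟨n - 2, by lia⟩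
      have h := ih (by lia)
      rw [pow_succ (Real.exp 1)]
      simp only [show m + 2 + 1 - 1 = m + 2 by lia, show m + 2 - 1 = m + 1 by lia] at h ⊢
      push_cast at h ⊢
      have hm : (0 : ℝ) ≤ m := by positivity
      have h2 : (0 : ℝ) < 2 ^ (m + 1) := by positivity
      calc (2 : ℝ) ^ (m + 2) * (((m : ℝ) + 2 + 1) * 1 + 1)
          ≤ 2 ^ (m + 1) * (((m : ℝ) + 2) * 1 + 1) * Real.exp 1 := by
            rw [pow_succ (2 : ℝ) (m + 1), mul_assoc, mul_assoc]
            refine mul_le_mul_of_nonneg_left ?_ h2.le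
            nlinarith
        _ ≤ _ := mul_le_mul_of_nonneg_right (by linarith) (Real.exp_pos 1).le

open Polynomial in
theorem intHeight_le_rpow {S : ℤ[X]} (hS : S.natDegree ≠ 0) {t D : ℕ} (ht : 0 < t) {Y : ℝ}
    (hY : Real.exp D ≤ Y) (hdeg : S.natDegree * t ≤ D)
    (hM : intMahler S ^ t ≤ (D + 1) * Y) :
    intHeight S ≤ Y ^ ((2 : ℝ) / t) := by
  have hY0 : 0 < Y := (Real.exp_pos _).trans_le hY
  have hD : D ≠ 0 := by
    have := Nat.mul_pos (Nat.pos_of_ne_zero hS) ht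
    lia
  have ht' : (0 : ℝ) < t := by exact_mod_cast ht
  have hS0 : S ≠ 0 := fun h => hS (by simp [h])
  have hM1 := one_le_intMahler hS0
  refine (intHeight_le_two_pow_mul_intMahler hS).trans ?_
  refine le_of_pow_le_pow_left₀ ht.ne' (by positivity) ?_
  rw [← Real.rpow_mul_natCast hY0.le, div_mul_cancel₀ _ ht'.ne', mul_pow, ← pow_mul]
  have hexp : (S.natDegree - 1) * t ≤ D - 1 := by
    rw [Nat.sub_mul, one_mul]
    lia
  calc (2 : ℝ) ^ ((S.natDegree - 1) * t) * intMahler S ^ t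
      ≤ 2 ^ (D - 1) * ((D + 1) * Y) := by
        gcongr
        norm_num
    _ = 2 ^ (D - 1) * (D + 1) * Y := by ring
    _ ≤ Y * Y := by
        gcongr
        exact (two_pow_mul_le_exp hD).trans hY
    _ = Y ^ (2 : ℝ) := by
        rw [Real.rpow_two]; ring

theorem exists_nat_mul_le_one_le_two_mul {x : ℝ} (hx : 0 < x) (hx1 : x ≤ 1) :
    ∃ k : ℕ, 1 ≤ k ∧ k * x ≤ 1 ∧ 1 ≤ 2 * (k * x) := by
  have h1 : 1 ≤ 1 / x := by rw [le_div_iff₀ hx]; linarith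
  have hk : 1 ≤ ⌊1 / x⌋₊ := (Nat.one_le_floor_iff _).2 h1
  have hk' : (1 : ℝ) ≤ ⌊1 / x⌋₊ := by exact_mod_cast hk
  refine ⟨⌊1 / x⌋₊, hk, ?_, ?_⟩
  · exact (le_div_iff₀ hx).1 (Nat.floor_le (by positivity))
  · have := (div_lt_iff₀ hx).1 (Nat.lt_floor_add_one (1 / x))
    nlinarith

open Polynomial in
/-- Among the powers of a polynomial `R` with `R ^ t` small, some power is itself small to the
scale `1 / t` and has nearly maximal exponent. -/
theorem exists_pow_small {R : ℤ[X]} (hR : R.natDegree ≠ 0) {t D : ℕ} (ht : 0 < t) {L : ℝ}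
    (hL : 0 < L) (hdeg : R.natDegree * t ≤ D) (hM : t * Real.log (intMahler R) ≤ L) :
    ∃ k : ℕ, 1 ≤ k ∧ R.natDegree * k * t ≤ D ∧ k * t * Real.log (intMahler R) ≤ L ∧
      1 ≤ 2 * t * k * ((R.natDegree : ℝ) / D + Real.log (intMahler R) / L) := by
  have hR0 : R ≠ 0 := fun h => hR (by simp [h])
  have hD : 0 < D := (Nat.mul_pos (Nat.pos_of_ne_zero hR) ht).trans_le hdeg
  have hD' : (0 : ℝ) < D := by exact_mod_cast hD
  have ht' : (0 : ℝ) < t := by exact_mod_cast ht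
  have hlog : 0 ≤ Real.log (intMahler R) := Real.log_nonneg (one_le_intMahler hR0)
  have ha : 0 < (R.natDegree : ℝ) / D := by
    have : (0 : ℝ) < R.natDegree := by exact_mod_cast Nat.pos_of_ne_zero hR
    positivity
  have hb : 0 ≤ Real.log (intMahler R) / L := by positivity
  have hdeg' : (R.natDegree : ℝ) * t ≤ D := by exact_mod_cast hdeg
  set w := max ((R.natDegree : ℝ) / D) (Real.log (intMahler R) / L) with hw
  have hw0 : 0 < w := ha.trans_le (le_max_left _ _)
  have hw1 : t * w ≤ 1 := by
    rw [hw, mul_max_of_nonneg _ _ ht'.le]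
    refine max_le ?_ ?_
    · rw [mul_div_assoc', div_le_one hD']; linarith
    · rw [mul_div_assoc', div_le_one hL]; exact hM
  obtain ⟨k, hk, hk1, hk2⟩ := exists_nat_mul_le_one_le_two_mul (mul_pos ht' hw0) hw1
  have hkt : (0 : ℝ) ≤ k * t := by positivity
  refine ⟨k, hk, ?_, ?_, ?_⟩
  · have h1 := (mul_le_mul_of_nonneg_left (le_max_left _ _ : _ ≤ w) hkt).trans
      ((mul_assoc _ _ _).trans_le hk1)
    rw [mul_div_assoc', div_le_one hD'] at h1
    have : ((R.natDegree * k * t : ℕ) : ℝ) ≤ D := by push_cast; linarith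
    exact_mod_cast this
  · have h1 := (mul_le_mul_of_nonneg_left (le_max_right _ _ : _ ≤ w) hkt).trans
      ((mul_assoc _ _ _).trans_le hk1)
    rwa [mul_div_assoc', div_le_one hL] at h1
  · have h1 : w ≤ (R.natDegree : ℝ) / D + Real.log (intMahler R) / L :=
      max_le (by linarith) (by linarith)
    have := mul_le_mul_of_nonneg_left h1 hkt
    linarith

open Polynomial in
theorem isPrimitive_pow {P : ℤ[X]} (hP : P.IsPrimitive) (n : ℕ) : (P ^ n).IsPrimitive := by
  induction n with
  | zero => simp [isPrimitive_one]
  | succ n ih => exact pow_succ P n ▸ ih.mul hP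

open Polynomial in
theorem intHeight_C {n : ℤ} (hn : n ≠ 0) : intHeight (C n) = 1 := by
  have : (|n| : ℝ) ≠ 0 := by simpa using hn
  rw [intHeight, content_C, ← Int.abs_eq_normalize, natDegree_C]
  simp only [zero_add, Finset.range_one, Finset.sup_singleton, coeff_C_zero, Nat.cast_natAbs]
  push_cast
  exact div_self this

open Polynomial in
/-- If all the primes `p` of `ℤ` satisfy `1 ≤ φ p`, then so do all nonzero integers. -/
theorem one_le_map_C {φ : ℤ[X] → ℝ} (hφmul : ∀ F G : ℤ[X], φ (F * G) = φ F * φ G)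
    (hunit : ∀ u, IsUnit u → φ u = 1) (hprime : ∀ p : ℤ, Irreducible p → 1 ≤ φ (C p))
    {n : ℤ} (hn : n ≠ 0) : 1 ≤ φ (C n) := by
  induction n using WfDvdMonoid.induction_on_irreducible with
  | zero => exact absurd rfl hn
  | unit u hu => exact (hunit _ (isUnit_C.2 hu)).ge
  | mul a i ha hi ih =>
    rw [C_mul, hφmul]
    exact one_le_mul_of_one_le_of_one_le (hprime i hi) (ih ha)

open Polynomial in
theorem map_isUnit_eq_one {φ : ℤ[X] → ℝ} (hφ0 : ∀ F, 0 ≤ φ F)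
    (hφmul : ∀ F G : ℤ[X], φ (F * G) = φ F * φ G) (h1 : φ 1 = 1) {u : ℤ[X]} (hu : IsUnit u) :
    φ u = 1 := by
  obtain ⟨r, hr, rfl⟩ := isUnit_iff.1 hu
  have h : φ (C r) * φ (C r) = 1 := by
    rw [← hφmul, ← C_mul, Int.isUnit_mul_self hr, C_1, h1]
  nlinarith [hφ0 (C r)]

open Polynomial in
theorem map_pow_of_map_mul {φ : ℤ[X] → ℝ} (hφmul : ∀ F G : ℤ[X], φ (F * G) = φ F * φ G)
    (h1 : φ 1 = 1) (F : ℤ[X]) (n : ℕ) : φ (F ^ n) = φ F ^ n := by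
  induction n with
  | zero => simpa using h1
  | succ n ih => rw [pow_succ, pow_succ, hφmul, ih]

open Polynomial in
/-- A lower bound on the irreducible divisors of `A` which is exponential in the degree and the
logarithm of the Mahler measure extends to `A`. -/
theorem rpow_le_map_of_irreducible {φ : ℤ[X] → ℝ} (hφ0 : ∀ F, 0 ≤ φ F)
    (hφmul : ∀ F G : ℤ[X], φ (F * G) = φ F * φ G) (hunit : ∀ u, IsUnit u → φ u = 1)
    {δ a b : ℝ} (hδ0 : 0 < δ) (hδ1 : δ ≤ 1) (hb : 0 ≤ b) (ha : 0 ≤ a) {A : ℤ[X]} (hA : A ≠ 0)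
    (hirr : ∀ R, Irreducible R → R ∣ A →
      δ ^ (a * R.natDegree + b * Real.log (intMahler R)) ≤ φ R) :
    δ ^ (a * A.natDegree + b * Real.log (intMahler A)) ≤ φ A := by
  induction A using WfDvdMonoid.induction_on_irreducible with
  | zero => exact absurd rfl hA
  | unit u hu =>
    rw [hunit u hu]
    have := Real.log_nonneg (one_le_intMahler hA)
    exact Real.rpow_le_one hδ0.le hδ1 (by positivity)
  | mul A R hA0 hR ih =>
    have h1 := ih hA0 fun S hS hSA => hirr S hS (hSA.mul_left R)
    have h2 := hirr R hR (dvd_mul_right _ _)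
    have hM1 := one_le_intMahler hA0
    have hM2 := one_le_intMahler hR.ne_zero
    rw [hφmul, natDegree_mul hR.ne_zero hA0, intMahler_mul,
      Real.log_mul (by positivity) (by positivity)]
    calc _ = δ ^ (a * R.natDegree + b * Real.log (intMahler R)) *
          δ ^ (a * A.natDegree + b * Real.log (intMahler A)) := by
          rw [← Real.rpow_add hδ0]
          push_cast
          ring_nf
      _ ≤ _ := mul_le_mul h2 h1 (by positivity) (hφ0 R)

open Polynomial in
/-- linearization lemma. -/
theorem stmt_15 (φ : Polynomial ℤ → ℝ) (hφ0 : ∀ F, 0 ≤ φ F)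
    (hφmul : ∀ F G : Polynomial ℤ, φ (F * G) = φ F * φ G)
    (δ d Y : ℝ) (hδ0 : 0 < δ) (hδ1 : δ < 1) (hd : 0 < d) (hY : Real.exp d ≤ Y)
    (t : ℕ) (ht : 0 < t)
    (hyp : ∃ Q₁ Q : Polynomial ℤ, Q₁ ≠ 0 ∧ (Q₁.natDegree : ℝ) ≤ d ∧ intHeight Q₁ ≤ Y ∧
      IsGCDOf Q {F | ∃ j < t, F = Polynomial.hasseDeriv j Q₁} ∧ φ Q ≤ δ) :
    ∃ S : Polynomial ℤ, IsPrimary S ∧ (S.natDegree : ℝ) ≤ d / t ∧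
      intHeight S ≤ Y ^ ((2 : ℝ) / t) ∧ φ S ≤ δ ^ ((1 : ℝ) / (6 * t)) := by
  obtain ⟨P, Q, hP, hdP, hHP, ⟨hQdvd, -⟩, hφQ⟩ := hyp
  by_contra! hS
  have ht' : (0 : ℝ) < t := by exact_mod_cast ht
  have hY1 : 1 < Y := (Real.one_lt_exp_iff.2 hd).trans_le hY
  set ε := δ ^ ((1 : ℝ) / (6 * t)) with hε
  have hε0 : 0 < ε := by positivity
  have hε1 : ε ≤ 1 := Real.rpow_le_one hδ0.le hδ1.le (by positivity)
  have hconst (p : ℤ) (hp : Irreducible p) (n : ℕ) : ε < φ (C p ^ (n + 1)) := by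
    refine hS _ ⟨C p, n + 1, (prime_C_iff.2 hp.prime).irreducible, by lia, rfl⟩ ?_ ?_
    · rw [← C_pow, natDegree_C]
      simp only [Nat.cast_zero]
      positivity
    · rw [← C_pow, intHeight_C (pow_ne_zero _ hp.ne_zero)]
      exact Real.one_le_rpow hY1.le (by positivity)
  have hφ1 : φ 1 = 1 := by
    have h2 := hconst 2 Int.prime_two.irreducible 0
    have h3 := hφmul (C 2 ^ (0 + 1)) 1
    rw [mul_one] at h3
    exact (mul_eq_left₀ (hε0.trans h2).ne').1 h3.symm
  have hunit (u : ℤ[X]) (hu : IsUnit u) : φ u = 1 := map_isUnit_eq_one hφ0 hφmul hφ1 hu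
  have hprime (p : ℤ) (hp : Irreducible p) : 1 ≤ φ (C p) := by
    by_contra! hlt
    obtain ⟨n, hn⟩ := exists_pow_lt_of_lt_one hε0 hlt
    have h1 := hconst p hp n
    rw [map_pow_of_map_mul hφmul hφ1] at h1
    have h2 := pow_le_pow_of_le_one (hφ0 (C p)) hlt.le (Nat.le_succ n)
    exact (h1.trans_le h2).not_gt hn
  have hQP : Q ∣ P := hQdvd P ⟨0, ht, by simp⟩
  have hQ : Q ≠ 0 := ne_zero_of_dvd_ne_zero hP hQP
  have hφQ' : φ Q.primPart ≤ δ := by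
    have h1 := one_le_map_C hφmul hunit hprime (content_eq_zero_iff.not.2 hQ)
    have h2 := hφmul (C Q.content) Q.primPart
    rw [← eq_C_content_mul_primPart] at h2
    nlinarith [hφ0 Q.primPart]
  set D := P.natDegree with hDdef
  set L := Real.log ((D + 1) * Y) with hL
  have hL0 : 0 < L := by
    refine Real.log_pos ?_
    have : (0 : ℝ) ≤ D := by positivity
    nlinarith
  have hDY : Real.exp D ≤ Y := (Real.exp_le_exp.2 hdP).trans hY
  have hMP : intMahler P.primPart ≤ (D + 1) * Y :=
    (intMahler_primPart_le hP).trans (by gcongr)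
  have hlogdvd {A : ℤ[X]} (hA : A ∣ P.primPart) : Real.log (intMahler A) ≤ L := by
    have h0 : A ≠ 0 := ne_zero_of_dvd_ne_zero (primPart_ne_zero P) hA
    refine Real.log_le_log (zero_lt_one.trans_le (one_le_intMahler h0)) ?_
    exact (intMahler_le_of_dvd hA (primPart_ne_zero P)).trans hMP
  have hirr (R : ℤ[X]) (hR : Irreducible R) (hRQ : R ∣ Q.primPart) :
      δ ^ ((3 * (D : ℝ))⁻¹ * R.natDegree + (3 * L)⁻¹ * Real.log (intMahler R)) ≤ φ R := by
    have hRprim : R.IsPrimitive := isPrimitive_of_dvd Q.isPrimitive_primPart hRQ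
    have hdeg : R.natDegree ≠ 0 := by
      intro h
      obtain ⟨r, rfl⟩ := natDegree_eq_zero.1 h
      exact hR.not_isUnit (isUnit_C.2 (hRprim r dvd_rfl))
    have hRt : R ^ t ∣ P := by
      refine pow_dvd_of_dvd_iterate_derivative hR hdeg t P fun j hj => ?_
      rw [← factorial_smul_hasseDeriv, LinearMap.smul_apply, nsmul_eq_mul]
      exact ((hRQ.trans Q.primPart_dvd).trans (hQdvd _ ⟨j, hj, rfl⟩)).mul_left _
    have hRtP : R ^ t ∣ P.primPart := (IsPrimitive.dvd_primPart_iff_dvd (isPrimitive_pow hRprim t) hP).2 hRt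
    have hRtD : R.natDegree * t ≤ D := by
      have := natDegree_le_of_dvd hRt hP
      rwa [natDegree_pow, mul_comm] at this
    have hRtM : t * Real.log (intMahler R) ≤ L := by
      have := hlogdvd hRtP
      rwa [intMahler_pow, Real.log_pow] at this
    obtain ⟨k, hk, hkD, hkM, hkw⟩ := exists_pow_small hdeg ht hL0 hRtD hRtM
    have hk' : (0 : ℝ) < k := by exact_mod_cast hk
    have hM1 := one_le_intMahler hR.ne_zero
    have hlt : ε < φ (R ^ k) := by
      refine hS _ ⟨R, k, hR, hk, rfl⟩ ?_ ?_
      · rw [le_div_iff₀ ht', natDegree_pow]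
        refine le_trans ?_ hdP
        rw [mul_comm k]
        exact_mod_cast hkD
      · refine intHeight_le_rpow (D := D) ?_ ht hDY ?_ ?_
        · rw [natDegree_pow]
          exact Nat.mul_ne_zero (by lia) hdeg
        · rwa [natDegree_pow, mul_comm k]
        · rw [intMahler_pow, ← pow_mul, ← Real.log_le_log_iff (by positivity) (by positivity),
            Real.log_pow]
          push_cast
          exact hkM
    rw [map_pow_of_map_mul hφmul hφ1] at hlt
    refine le_of_pow_le_pow_left₀ (by lia : k ≠ 0) (hφ0 R) (le_trans ?_ hlt.le)
    rw [← Real.rpow_mul_natCast hδ0.le]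
    refine Real.rpow_le_rpow_of_exponent_ge hδ0 hδ1.le ?_
    rw [div_le_iff₀ (by positivity)]
    refine hkw.trans_eq ?_
    rw [mul_inv, mul_inv]
    ring
  have hQP' : Q.primPart ∣ P.primPart :=
    (IsPrimitive.dvd_primPart_iff_dvd Q.isPrimitive_primPart hP).2 (Q.primPart_dvd.trans hQP)
  have hmain := rpow_le_map_of_irreducible hφ0 hφmul hunit hδ0 hδ1.le
    (by positivity) (by positivity) (primPart_ne_zero Q) hirr
  have hexp : (3 * (D : ℝ))⁻¹ * Q.primPart.natDegree +
      (3 * L)⁻¹ * Real.log (intMahler Q.primPart) < 1 := by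
    have h1 : (D : ℝ)⁻¹ * Q.primPart.natDegree ≤ 1 := by
      rw [natDegree_primPart, inv_mul_eq_div]
      refine div_le_one_of_le₀ ?_ (by positivity)
      exact_mod_cast natDegree_le_of_dvd hQP hP
    have h2 : L⁻¹ * Real.log (intMahler Q.primPart) ≤ 1 := by
      rw [inv_mul_eq_div, div_le_one hL0]
      exact hlogdvd hQP'
    rw [mul_inv, mul_inv]
    linarith
  have := Real.rpow_lt_rpow_of_exponent_gt hδ0 hδ1 hexp
  rw [Real.rpow_one] at this
  linarith
end

section
/- Let d be a positive integer, let Φ ∈ ℤ[T] be a cyclotomic polynomial of degree at most d, and let ζ be a root of Φ. Denote by ℓ the order of ζ as a root of unity, and by g its multiplicity as a root of Φ. Then ℓ ≤ 2d·log₂(2d)/g ≤ 2d², where log₂ is the logarithm in base 2. -/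
/-- A cyclotomic polynomial: a monic polynomial of `ℤ[T]` all of whose complex roots are
roots of unity. -/
def IsCyclo (Φ : Polynomial ℤ) : Prop :=
  Φ.Monic ∧ ∀ z : ℂ, Polynomial.aeval z Φ = 0 → IsRootOfUnity z

open Polynomial in
/-- The multiplicity of a primitive `ℓ`-th root of unity as a root of a monic integer
polynomial, times `φ(ℓ)`, is at most the degree of the polynomial. -/
theorem rootMultiplicity_mul_totient_le_natDegree {ζ : ℂ} {ℓ : ℕ} (hpos : 0 < ℓ)
    (hζ : IsPrimitiveRoot ζ ℓ) (Φ : ℤ[X]) (hΦ : Φ.Monic) :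
    (Φ.map (Int.castRingHom ℂ)).rootMultiplicity ζ * ℓ.totient ≤ Φ.natDegree := by
  induction hn : Φ.natDegree using Nat.strong_induction_on generalizing Φ with
  | _ n ih =>
    subst hn
    by_cases hroot : aeval ζ Φ = 0
    · have hdvd : cyclotomic ℓ ℤ ∣ Φ := by
        rw [cyclotomic_eq_minpoly hζ hpos]
        exact minpoly.isIntegrallyClosed_dvd (hζ.isIntegral hpos) hroot
      obtain ⟨Q, rfl⟩ := hdvd
      have hQ : Q.Monic := (cyclotomic.monic ℓ ℤ).of_mul_monic_left hΦ
      have hdeg : (cyclotomic ℓ ℤ * Q).natDegree = ℓ.totient + Q.natDegree := by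
        rw [(cyclotomic.monic ℓ ℤ).natDegree_mul hQ, natDegree_cyclotomic]
      have htot : 0 < ℓ.totient := Nat.totient_pos.2 hpos
      have hle := ih Q.natDegree (by omega) Q hQ rfl
      have hne : (cyclotomic ℓ ℤ * Q).map (Int.castRingHom ℂ) ≠ 0 := (hΦ.map _).ne_zero
      have : NeZero (ℓ : ℂ) := ⟨by exact_mod_cast hpos.ne'⟩
      have hone : (cyclotomic ℓ ℂ).rootMultiplicity ζ ≤ 1 :=
        rootMultiplicity_le_one_of_separable (separable_cyclotomic ℓ ℂ) ζ
      rw [Polynomial.map_mul] at hne ⊢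
      rw [rootMultiplicity_mul hne, map_cyclotomic, hdeg, add_mul]
      have := Nat.mul_le_mul_right ℓ.totient hone
      omega
    · rw [rootMultiplicity_eq_zero, zero_mul]
      · exact Nat.zero_le _
      · rwa [IsRoot.def, eval_map, ← algebraMap_int_eq, ← aeval_def]

/-- For a finite set `S` of integers at least `2`, `∏ p ≤ (|S| + 1) ∏ (p - 1)`. -/
theorem Finset.prod_le_card_add_one_mul_prod_sub_one (S : Finset ℕ) (hS : ∀ p ∈ S, 2 ≤ p) :
    ∏ p ∈ S, p ≤ (S.card + 1) * ∏ p ∈ S, (p - 1) := by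
  induction S using Finset.induction_on_max with
  | empty => simp
  | insert p S hmax ih =>
    have hp : p ∉ S := fun h => (hmax p h).false
    have hle := ih fun q hq => hS q (Finset.mem_insert_of_mem hq)
    have hcard : S.card ≤ p - 2 := by
      rw [← Nat.card_Ico]
      exact Finset.card_le_card fun q hq =>
        Finset.mem_Ico.2 ⟨hS q (Finset.mem_insert_of_mem hq), hmax q hq⟩
    obtain ⟨r, rfl⟩ := Nat.exists_eq_add_of_le (hS p (Finset.mem_insert_self p S))
    rw [Finset.prod_insert hp, Finset.prod_insert hp, Finset.card_insert_of_notMem hp]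
    have hr : 2 + r - 1 = r + 1 := by omega
    have hc : S.card ≤ r := by omega
    rw [hr]
    calc (2 + r) * ∏ q ∈ S, q ≤ (2 + r) * ((S.card + 1) * ∏ q ∈ S, (q - 1)) := by gcongr
      _ = ((2 + r) * (S.card + 1)) * ∏ q ∈ S, (q - 1) := by ring
      _ ≤ ((S.card + 1 + 1) * (r + 1)) * ∏ q ∈ S, (q - 1) :=
          Nat.mul_le_mul_right _ (by nlinarith)
      _ = _ := by ring

/-- For a finite set `S` of integers at least `2`, `2 ^ |S| ≤ 2 ∏ (p - 1)`. -/
theorem Finset.two_pow_card_le_two_mul_prod_sub_one (S : Finset ℕ) (hS : ∀ p ∈ S, 2 ≤ p) :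
    2 ^ S.card ≤ 2 * ∏ p ∈ S, (p - 1) := by
  induction S using Finset.induction_on_max with
  | empty => simp
  | insert p S hmax ih =>
    have hp : p ∉ S := fun h => (hmax p h).false
    have hle := ih fun q hq => hS q (Finset.mem_insert_of_mem hq)
    have hp2 := hS p (Finset.mem_insert_self p S)
    rw [Finset.prod_insert hp, Finset.card_insert_of_notMem hp]
    rcases S.eq_empty_or_nonempty with rfl | ⟨q, hq⟩
    · simp
      omega
    · have hq2 := hS q (Finset.mem_insert_of_mem hq)
      have hqp := hmax q hq
      calc 2 ^ (S.card + 1) = 2 * 2 ^ S.card := by ring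
        _ ≤ (p - 1) * (2 * ∏ q ∈ S, (q - 1)) := Nat.mul_le_mul (by omega) hle
        _ = _ := by ring

theorem Nat.le_card_primeFactors_add_one_mul_totient (n : ℕ) :
    n ≤ (n.primeFactors.card + 1) * n.totient := by
  have hS : ∀ p ∈ n.primeFactors, 2 ≤ p := fun p hp => (Nat.prime_of_mem_primeFactors hp).two_le
  have hprod := Finset.prod_le_card_add_one_mul_prod_sub_one _ hS
  have hpos : 0 < ∏ p ∈ n.primeFactors, (p - 1) :=
    Finset.prod_pos fun p hp => by have := hS p hp; omega
  refine Nat.le_of_mul_le_mul_right ?_ hpos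
  rw [← Nat.totient_mul_prod_primeFactors]
  calc _ ≤ n.totient * _ := Nat.mul_le_mul_left _ hprod
    _ = _ := by ring

theorem Nat.two_pow_card_primeFactors_le_two_mul_totient {n : ℕ} (hn : 0 < n) :
    2 ^ n.primeFactors.card ≤ 2 * n.totient := by
  have hS : ∀ p ∈ n.primeFactors, 2 ≤ p := fun p hp => (Nat.prime_of_mem_primeFactors hp).two_le
  refine (Finset.two_pow_card_le_two_mul_prod_sub_one _ hS).trans (Nat.mul_le_mul_left 2 ?_)
  refine Nat.le_of_mul_le_mul_left ?_ hn
  rw [← Nat.totient_mul_prod_primeFactors, mul_comm n]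
  exact Nat.mul_le_mul_left _ (Nat.le_of_dvd hn (Nat.prod_primeFactors_dvd n))

theorem Nat.cast_le_two_mul_totient_mul_logb {n : ℕ} (hn : 0 < n) :
    (n : ℝ) ≤ 2 * n.totient * Real.logb 2 (2 * n.totient) := by
  have htot : (1 : ℝ) ≤ n.totient := by exact_mod_cast Nat.totient_pos.2 hn
  have hlog : (n.primeFactors.card : ℝ) ≤ Real.logb 2 (2 * n.totient) := by
    rw [Real.le_logb_iff_rpow_le one_lt_two (by positivity), Real.rpow_natCast]
    exact_mod_cast Nat.two_pow_card_primeFactors_le_two_mul_totient hn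
  have hlog_one : 1 ≤ Real.logb 2 (2 * n.totient) := by
    rw [Real.le_logb_iff_rpow_le one_lt_two (by positivity), Real.rpow_one]
    linarith
  have hle : (n : ℝ) ≤ (n.primeFactors.card + 1) * n.totient := by
    exact_mod_cast Nat.le_card_primeFactors_add_one_mul_totient n
  nlinarith

theorem Nat.two_mul_le_two_pow (d : ℕ) : 2 * d ≤ 2 ^ d := by
  cases d with
  | zero => simp
  | succ k =>
    rw [pow_succ']
    exact Nat.mul_le_mul_left 2 Nat.lt_two_pow_self

theorem stmt_16 (d : ℕ) (hd : 0 < d) (Φ : Polynomial ℤ) (hΦ : IsCyclo Φ)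
    (hdeg : Φ.natDegree ≤ d) (ζ : ℂ) (hroot : Polynomial.aeval ζ Φ = 0)
    (ℓ : ℕ) (hℓpos : 0 < ℓ) (hℓ : IsPrimitiveRoot ζ ℓ)
    (g : ℕ) (hg : g = (Φ.map (Int.castRingHom ℂ)).rootMultiplicity ζ) :
    (ℓ : ℝ) ≤ 2 * d * Real.logb 2 (2 * d) / g ∧
      2 * d * Real.logb 2 (2 * d) / g ≤ 2 * (d : ℝ) ^ 2 := by
  have hmul : g * ℓ.totient ≤ d :=
    hg ▸ (rootMultiplicity_mul_totient_le_natDegree hℓpos hℓ Φ hΦ.1).trans hdeg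
  have hgpos : 0 < g := by
    rw [hg, Polynomial.rootMultiplicity_pos (hΦ.1.map _).ne_zero, Polynomial.IsRoot.def,
      Polynomial.eval_map, ← algebraMap_int_eq, ← Polynomial.aeval_def]
    exact hroot
  have hg1 : (1 : ℝ) ≤ g := by exact_mod_cast hgpos
  have hd1 : (1 : ℝ) ≤ d := by exact_mod_cast hd
  have htot : (1 : ℝ) ≤ ℓ.totient := by exact_mod_cast Nat.totient_pos.2 hℓpos
  have hmulR : (g : ℝ) * ℓ.totient ≤ d := by exact_mod_cast hmul
  have htot_le : (ℓ.totient : ℝ) ≤ d := by nlinarith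
  have hlog_nonneg : 0 ≤ Real.logb 2 (2 * ℓ.totient) :=
    Real.logb_nonneg one_lt_two (by linarith)
  have hlog_mono : Real.logb 2 (2 * ℓ.totient) ≤ Real.logb 2 (2 * d) :=
    Real.logb_le_logb_of_le one_lt_two (by positivity) (by linarith)
  constructor
  · rw [le_div_iff₀ (by positivity)]
    calc (ℓ : ℝ) * g ≤ 2 * ℓ.totient * Real.logb 2 (2 * ℓ.totient) * g := by
          gcongr
          exact Nat.cast_le_two_mul_totient_mul_logb hℓpos
      _ = 2 * (g * ℓ.totient) * Real.logb 2 (2 * ℓ.totient) := by ring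
      _ ≤ 2 * d * Real.logb 2 (2 * d) := by gcongr
  · have hlog_le : Real.logb 2 (2 * d) ≤ d := by
      rw [Real.logb_le_iff_le_rpow one_lt_two (by positivity), Real.rpow_natCast]
      exact_mod_cast Nat.two_mul_le_two_pow d
    calc 2 * d * Real.logb 2 (2 * d) / g ≤ 2 * d * Real.logb 2 (2 * d) :=
          div_le_self (mul_nonneg (by positivity) (hlog_nonneg.trans hlog_mono)) hg1
      _ ≤ 2 * d * d := by gcongr
      _ = 2 * (d : ℝ) ^ 2 := by ring
end
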